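/- arXiv:0707.1473 — 4 statements merged into one kernel-verified Lean document; each statement's English description precedes it below -/
import Mathlib

section
/- Let p be a real number with 0 < p ≤ 1/3 and let α be a real number with −1 < α ≤ 0. Set λ_n = n^α and Λ_n = Σ_{i=1}^n i^α. Then for every nonnegative real sequence (a_n) with Σ_{k=1}^∞ k^α a_k < ∞ one has Σ_{n=1}^∞ ( (Σ_{k=n}^∞ k^α a_k)^p / Λ_n^p ) ≥ ( (1+α)p/(1−(1+α)p) )^p · Σ_{n=1}^∞ a_n^p. -/
/-- The concave function `y ↦ y ^ q`, `0 ≤ q ≤ 1`, lies below its tangent at `z`. -/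
theorem rpow_le_tangent {q y z : ℝ} (hq : 0 ≤ q) (hq' : q ≤ 1) (hy : 0 ≤ y) (hz : 0 < z) :
    y ^ q ≤ z ^ q + q * z ^ (q - 1) * (y - z) := by
  have h := rpow_one_add_le_one_add_mul_self (s := y / z - 1)
    (by linarith [div_nonneg hy hz.le]) hq hq'
  have e : 1 + (y / z - 1) = y / z := by ring
  rw [e, Real.div_rpow hy hz.le, div_le_iff₀ (Real.rpow_pos_of_pos hz q)] at h
  refine h.trans (le_of_eq ?_)
  rw [Real.rpow_sub_one hz.ne']
  field_simp

/-- For `z ≥ 1` the tangent to `y ↦ y ^ q` at `z` has slope at most `q`. -/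
theorem rpow_add_le_of_one_le {q z d : ℝ} (hq : 0 ≤ q) (hq' : q ≤ 1) (hz : 1 ≤ z) (hd : 0 ≤ d) :
    (z + d) ^ q ≤ z ^ q + q * d := by
  have h := rpow_le_tangent hq hq' (by linarith : 0 ≤ z + d) (by linarith : 0 < z)
  have h1 : z ^ (q - 1) ≤ 1 := Real.rpow_le_one_of_one_le_of_nonpos hz (by linarith)
  have h2 : q * z ^ (q - 1) * (z + d - z) ≤ q * d := by
    have := mul_le_mul_of_nonneg_left h1 (mul_nonneg hq hd)
    nlinarith
  linarith

/-- Two-term Hölder inequality in homogeneous form. -/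
theorem rpow_mul_rpow_add_le {p x y b w : ℝ} (hp : 0 < p) (hp' : p < 1) (hx : 0 ≤ x) (hy : 0 ≤ y)
    (hb : 0 < b) (hw : 0 ≤ w) :
    x ^ p * b ^ (1 - p) + y ^ p * w ^ (1 - p) ≤ (x + y) ^ p * (b + w) ^ (1 - p) := by
  rcases (add_nonneg hx hy).eq_or_lt with h0 | h0
  · have hx0 : x = 0 := by linarith
    have hy0 : y = 0 := by linarith
    simp [hx0, hy0, Real.zero_rpow hp.ne']
  have hbw : 0 < b + w := by linarith
  have h1 := Real.geom_mean_le_arith_mean2_weighted hp.le (by linarith : 0 ≤ 1 - p)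
    (div_nonneg hx h0.le) (div_nonneg hb.le hbw.le) (by ring)
  have h2 := Real.geom_mean_le_arith_mean2_weighted hp.le (by linarith : 0 ≤ 1 - p)
    (div_nonneg hy h0.le) (div_nonneg hw hbw.le) (by ring)
  rw [Real.div_rpow hx h0.le, Real.div_rpow hb.le hbw.le] at h1
  rw [Real.div_rpow hy h0.le, Real.div_rpow hw hbw.le] at h2
  have e : p * (x / (x + y)) + (1 - p) * (b / (b + w)) +
      (p * (y / (x + y)) + (1 - p) * (w / (b + w))) = 1 := by
    field_simp
    ring
  have hP := Real.rpow_pos_of_pos h0 p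
  have hQ := Real.rpow_pos_of_pos hbw (1 - p)
  have h3 := (add_le_add h1 h2).trans_eq e
  rw [div_mul_div_comm, div_mul_div_comm, ← add_div, div_le_one (mul_pos hP hQ)] at h3
  exact h3

/-- Comparison of increments of `u ↦ u ^ (1 - p)` with those of `u ↦ u ^ (2 / 3)`. -/
theorem rpow_sub_rpow_le {p u v : ℝ} (hp : 0 < p) (hp' : p ≤ 1 / 3) (hv : 0 ≤ v) (huv : v ≤ u) :
    u ^ (1 - p) - v ^ (1 - p) ≤
      (1 - p) * ((1 - 3 * p) * (u - v) + 9 * p / 2 * (u ^ (2 / 3 : ℝ) - v ^ (2 / 3 : ℝ))) := by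
  set f : ℝ → ℝ := fun t =>
    (1 - p) * ((1 - 3 * p) * t + 9 * p / 2 * t ^ (2 / 3 : ℝ)) - t ^ (1 - p) with hf
  have hd : ∀ t : ℝ, 0 < t → HasDerivAt f
      ((1 - p) * ((1 - 3 * p) * 1 + 9 * p / 2 * ((2 / 3 : ℝ) * t ^ ((2 / 3 : ℝ) - 1))) -
        (1 - p) * t ^ ((1 - p) - 1)) t := by
    intro t ht
    exact ((((hasDerivAt_id t).const_mul _).add
      ((Real.hasDerivAt_rpow_const (Or.inl ht.ne')).const_mul _)).const_mul _).sub
      (Real.hasDerivAt_rpow_const (Or.inl ht.ne'))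
  have hm : MonotoneOn f (Set.Ici 0) := by
    apply monotoneOn_of_deriv_nonneg (convex_Ici 0)
    · have h1 : Continuous fun t : ℝ => t ^ (2 / 3 : ℝ) :=
        Real.continuous_rpow_const (by norm_num)
      have h2 : Continuous fun t : ℝ => t ^ (1 - p) := Real.continuous_rpow_const (by linarith)
      exact Continuous.continuousOn (by fun_prop)
    · intro t ht
      rw [interior_Ici] at ht
      exact (hd t ht).differentiableAt.differentiableWithinAt
    · intro t ht
      rw [interior_Ici] at ht
      have ht' : 0 < t := ht
      rw [(hd t ht).deriv]
      have h := rpow_le_tangent (q := 3 * p) (y := t ^ (-(1 / 3) : ℝ)) (z := 1) (by linarith)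
        (by linarith) (Real.rpow_nonneg ht'.le _) one_pos
      rw [← Real.rpow_mul ht'.le, Real.one_rpow, Real.one_rpow] at h
      rw [show (1 - p) - 1 = -(1 / 3) * (3 * p) by ring,
        show (2 / 3 : ℝ) - 1 = -(1 / 3) by norm_num]
      have : 0 ≤ 1 - p := by linarith
      nlinarith
  have h := hm (Set.mem_Ici.2 hv) (Set.mem_Ici.2 (hv.trans huv)) huv
  simp only [hf] at h
  linarith

theorem le_cube_of_near_one {v : ℝ} (hv : v ≤ 1) (hv' : 73 / 100 ≤ v) :
    (5 / 2 - 3 / 2 * v ^ 3) ^ 2 ≤ (v ^ 2 + 5 / 3 * (1 - v ^ 3)) ^ 3 := by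
  obtain ⟨w, rfl⟩ : ∃ w, v = 1 - w := ⟨1 - v, by ring⟩
  have hw : 0 ≤ w := by linarith
  have hw' : w ≤ 27 / 100 := by linarith
  have h1 : 0 ≤ 15 / 4 - 5 / 2 * w - 255 / 4 * w ^ 2 + 114 * w ^ 3 := by
    nlinarith [mul_nonneg (by linarith : 0 ≤ w + 2 / 5) (sq_nonneg (w - 1 / 5)),
      mul_nonneg hw (by linarith : 0 ≤ 27 / 100 - w)]
  have h2 : 0 ≤ w ^ 3 * (325 / 2 - 114 - 2135 / 12 * w) :=
    mul_nonneg (by positivity) (by linarith)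
  have h3 : 0 ≤ w ^ 5 * (105 - 100 / 3 * w) := mul_nonneg (by positivity) (by linarith)
  have h4 : 0 ≤ w ^ 7 * (125 / 27) := by positivity
  have h5 := mul_nonneg (sq_nonneg w) (add_nonneg (add_nonneg (add_nonneg h1 h2) h3) h4)
  linarith [h5, show (((1 - w) ^ 2 + 5 / 3 * (1 - (1 - w) ^ 3)) ^ 3 -
    (5 / 2 - 3 / 2 * (1 - w) ^ 3) ^ 2 : ℝ) = w ^ 2 * (15 / 4 - 5 / 2 * w - 255 / 4 * w ^ 2 +
      114 * w ^ 3 + w ^ 3 * (325 / 2 - 114 - 2135 / 12 * w) + w ^ 5 * (105 - 100 / 3 * w) +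
      w ^ 7 * (125 / 27)) by ring]

theorem rpow_two_thirds_le {u w : ℝ} (hu : 0 ≤ u) (hw : 0 ≤ w) (h : u ^ 2 ≤ w ^ 3) :
    u ^ (2 / 3 : ℝ) ≤ w := by
  have h1 := Real.rpow_le_rpow (by positivity) h (by norm_num : (0 : ℝ) ≤ 1 / 3)
  rw [← Real.rpow_natCast, ← Real.rpow_natCast, ← Real.rpow_mul hu, ← Real.rpow_mul hw] at h1
  norm_num at h1
  exact h1

theorem rpow_two_thirds_increment_le {x : ℝ} (hx : 0 ≤ x) (hx' : x ≤ 1 / 2) :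
    (1 + 9 / 5 * x) ^ (2 / 3 : ℝ) ≤ 2 * x + (1 - 6 / 5 * x) ^ (2 / 3 : ℝ) := by
  have hV : 0 ≤ 1 - 6 / 5 * x := by linarith
  set v := (1 - 6 / 5 * x) ^ (1 / 3 : ℝ) with hv
  have hv0 : 0 ≤ v := Real.rpow_nonneg hV _
  have hv3 : v ^ 3 = 1 - 6 / 5 * x := by
    rw [hv, ← Real.rpow_natCast, ← Real.rpow_mul hV]
    norm_num
  have hv2 : (1 - 6 / 5 * x) ^ (2 / 3 : ℝ) = v ^ 2 := by
    rw [hv, ← Real.rpow_natCast, ← Real.rpow_mul hV]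
    norm_num
  have hv1 : v ≤ 1 := Real.rpow_le_one hV (by linarith) (by norm_num)
  have hv7 : 73 / 100 ≤ v := by
    by_contra! hlt
    have := pow_le_pow_left₀ hv0 hlt.le 3
    rw [hv3] at this
    norm_num at this
    linarith
  rw [hv2]
  refine rpow_two_thirds_le (by linarith) (by positivity) ?_
  have h := le_cube_of_near_one hv1 hv7
  rw [hv3] at h
  convert h using 2 <;> ring

theorem one_sub_le_rpow {c y : ℝ} (hc : 0 ≤ c) (hy : 0 < y) (hy' : y ≤ 1) :
    1 - c * (1 - y) / √y ≤ y ^ c := by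
  have hs : 0 < √y := Real.sqrt_pos.2 hy
  have hss : √y * √y = y := Real.mul_self_sqrt hy.le
  have h1 : 0 ≤ Real.log (√y)⁻¹ :=
    Real.log_nonneg ((one_le_inv₀ hs).2 (Real.sqrt_le_one.2 hy'))
  have h2 := Real.self_le_sinh_iff.2 h1
  rw [Real.sinh_log (inv_pos.2 hs), Real.log_inv, Real.log_sqrt hy.le, inv_inv] at h2
  have h3 : (√y)⁻¹ - √y = (1 - y) / √y := by
    field_simp
    linarith
  rw [h3] at h2
  have h4 := Real.add_one_le_exp (Real.log y * c)
  rw [← Real.rpow_def_of_pos hy] at h4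
  have h5 : c * (1 - y) / √y = c * ((1 - y) / √y) := by ring
  rw [h5]
  nlinarith

/-- Bound for increments starting at any `v ≥ 0`, given the corresponding bound at `p = 1 / 3`. -/
theorem rpow_le_of_two_thirds {p x v : ℝ} (hp : 0 < p) (hp' : p ≤ 1 / 3) (hx : 0 ≤ x)
    (hv : 0 ≤ v) (hv' : 1 - 6 / 5 * x ≤ v) (hv1 : v ≤ 1)
    (h : (1 + 9 / 5 * x) ^ (2 / 3 : ℝ) ≤ 2 * x + v ^ (2 / 3 : ℝ)) :
    (1 + (1 / p - 6 / 5) * x) ^ (1 - p) ≤ (1 / p - 1) * x + v ^ (1 - p) := by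
  have hP : 3 ≤ 1 / p := by
    rw [le_div_iff₀ hp]
    linarith
  obtain ⟨P, hPd⟩ : ∃ P, P = 1 / p := ⟨_, rfl⟩
  rw [← hPd] at hP ⊢
  have hpP : p * P = 1 := by
    rw [hPd]
    field_simp
  have hu : 1 + (P - 6 / 5) * x = 1 + 9 / 5 * x + (P - 3) * x := by ring
  have hPx : 0 ≤ (P - 3) * x := mul_nonneg (by linarith) hx
  have h1 := rpow_sub_rpow_le hp hp' hv (show v ≤ 1 + (P - 6 / 5) * x by nlinarith)
  have h2 : (1 + (P - 6 / 5) * x) ^ (2 / 3 : ℝ) ≤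
      (1 + 9 / 5 * x) ^ (2 / 3 : ℝ) + 2 / 3 * ((P - 3) * x) := by
    rw [hu]
    exact rpow_add_le_of_one_le (by norm_num) (by norm_num) (by linarith) hPx
  have h3 : (1 - 3 * p) * (1 + (P - 6 / 5) * x - v) ≤ (1 - 3 * p) * (P * x) :=
    mul_le_mul_of_nonneg_left (by linarith) (by linarith)
  have h4 : 9 * p / 2 * ((1 + (P - 6 / 5) * x) ^ (2 / 3 : ℝ) - v ^ (2 / 3 : ℝ)) ≤
      9 * p / 2 * (2 * x + 2 / 3 * ((P - 3) * x)) :=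
    mul_le_mul_of_nonneg_left (by linarith) (by linarith)
  have h5 := mul_le_mul_of_nonneg_left (add_le_add h3 h4) (by linarith : 0 ≤ 1 - p)
  have h6 : (1 - p) * ((1 - 3 * p) * (P * x) + 9 * p / 2 * (2 * x + 2 / 3 * ((P - 3) * x))) =
      (P - 1) * x := by
    linear_combination (-x) * hpP
  linarith

theorem rpow_add_le_base {p c : ℝ} (hp : 0 < p) (hp' : p ≤ 1 / 3) (hc : 0 ≤ c) :
    (4 / 5 + (1 / p - 1 + c)) ^ (1 - p) ≤ 1 / p - 1 + c := by
  have hP : 3 ≤ 1 / p := by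
    rw [le_div_iff₀ hp]
    linarith
  have h0 : (1 + 9 / 5 * 1 : ℝ) ^ (2 / 3 : ℝ) ≤ 2 * 1 + 0 ^ (2 / 3 : ℝ) := by
    rw [Real.zero_rpow (by norm_num)]
    exact rpow_two_thirds_le (by norm_num) (by norm_num) (by norm_num)
  have h1 := rpow_le_of_two_thirds hp hp' zero_le_one le_rfl (by norm_num) zero_le_one h0
  rw [Real.zero_rpow (by linarith)] at h1
  have h2 := rpow_add_le_of_one_le (by linarith : 0 ≤ 1 - p) (by linarith)
    (by linarith : 1 ≤ 1 + (1 / p - 6 / 5) * 1) hc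
  rw [show 4 / 5 + (1 / p - 1 + c) = 1 + (1 / p - 6 / 5) * 1 + c by ring]
  nlinarith

theorem rpow_add_le_scaled {p c x : ℝ} (hp : 0 < p) (hp' : p ≤ 1 / 3) (hc : 0 ≤ c) (hx : 0 ≤ x)
    (hx' : x ≤ 1 / 2) :
    (1 + (1 / p - 1 + c - 1 / 5) * x) ^ (1 - p) ≤
      (1 / p - 1 + c) * x + (1 - x) ^ (c * p) * (1 - 6 / 5 * x) ^ (1 - p) := by
  have hP : 3 ≤ 1 / p := by
    rw [le_div_iff₀ hp]
    linarith
  have hV : 0 < 1 - 6 / 5 * x := by linarith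
  have h1 := rpow_le_of_two_thirds hp hp' hx hV.le le_rfl (by linarith)
    (rpow_two_thirds_increment_le hx hx')
  have h2 := rpow_add_le_of_one_le (by linarith : 0 ≤ 1 - p) (by linarith)
    (by nlinarith : 1 ≤ 1 + (1 / p - 6 / 5) * x) (mul_nonneg hc hx)
  rw [show 1 + (1 / p - 1 + c - 1 / 5) * x = 1 + (1 / p - 6 / 5) * x + c * x by ring]
  have hs : 0 < √(1 - x) := Real.sqrt_pos.2 (by linarith)
  have h3 := one_sub_le_rpow (mul_nonneg hc hp.le) (by linarith : 0 < 1 - x) (by linarith)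
  have h4 : (1 - 6 / 5 * x) ^ (1 - p) ≤ √(1 - x) := by
    rw [Real.sqrt_eq_rpow]
    exact (Real.rpow_le_rpow_of_exponent_ge hV (by linarith) (by linarith)).trans
      (Real.rpow_le_rpow hV.le (by linarith) (by norm_num))
  have h5 := mul_le_mul_of_nonneg_right h3 (Real.rpow_nonneg hV.le (1 - p))
  have h6 : c * p * (1 - (1 - x)) / √(1 - x) * (1 - 6 / 5 * x) ^ (1 - p) ≤ c * p * x := by
    rw [div_mul_eq_mul_div, div_le_iff₀ hs, sub_sub_cancel]
    exact mul_le_mul_of_nonneg_left h4 (by positivity)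
  linarith

theorem rpow_mul_rpow_step {p c n : ℝ} (hp : 0 < p) (hp' : p ≤ 1 / 3) (hc : 0 ≤ c)
    (hn : 2 ≤ n) :
    n ^ (c * p) * (n - 1 / 5 + (1 / p - 1 + c)) ^ (1 - p) ≤
      (1 / p - 1 + c) * n ^ (c * p - p) +
        (n - 1) ^ (c * p) * (n - 1 - 1 / 5) ^ (1 - p) := by
  have hP : 3 ≤ 1 / p := by
    rw [le_div_iff₀ hp]
    linarith
  have hn0 : 0 < n := by linarith
  have hx : 1 / n ≤ 1 / 2 := one_div_le_one_div_of_le two_pos hn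
  have hx0 : 0 ≤ 1 / n := by positivity
  have h := mul_le_mul_of_nonneg_left (rpow_add_le_scaled hp hp' hc hx0 hx)
    (mul_nonneg (Real.rpow_nonneg hn0.le (c * p)) (Real.rpow_nonneg hn0.le (1 - p)))
  have e1 : n - 1 / 5 + (1 / p - 1 + c) = n * (1 + (1 / p - 1 + c - 1 / 5) * (1 / n)) := by
    field_simp
    ring
  have e2 : n - 1 = n * (1 - 1 / n) := by field_simp
  have e3 : n - 1 - 1 / 5 = n * (1 - 6 / 5 * (1 / n)) := by
    field_simp
    ring
  have e4 : n ^ (c * p - p) = n ^ (c * p) * n ^ (1 - p) * (1 / n) := by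
    rw [← Real.rpow_add hn0, mul_one_div, ← Real.rpow_sub_one hn0.ne']
    congr 1
    ring
  rw [e3, e1, e2, e4, Real.mul_rpow hn0.le (by nlinarith), Real.mul_rpow hn0.le (by linarith),
    Real.mul_rpow hn0.le (by linarith)]
  linarith

theorem sum_Icc_rpow_le {α : ℝ} (hα : -1 < α) (hα' : α ≤ 0) (n : ℕ) :
    ∑ i ∈ Finset.Icc 1 n, (i : ℝ) ^ α ≤ (n : ℝ) ^ (1 + α) / (1 + α) := by
  have h1 : 0 < 1 + α := by linarith
  induction n with
  | zero => simp [Real.zero_rpow h1.ne']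
  | succ n ih =>
    rw [Finset.sum_Icc_succ_top (by omega)]
    have h := rpow_le_tangent h1.le (by linarith) (Nat.cast_nonneg n : (0 : ℝ) ≤ n)
      (by positivity : (0 : ℝ) < (n + 1 : ℕ))
    rw [le_div_iff₀ h1] at ih ⊢
    rw [add_sub_cancel_left] at h
    push_cast at *
    nlinarith

/-- The potential-function step: the weight in front of `A_n ^ p` is absorbed by `Λ_n ^ (-p)` and
the previous weight. -/
theorem weight_step {p α : ℝ} (hp : 0 < p) (hp' : p ≤ 1 / 3) (hα : -1 < α) (hα' : α ≤ 0)
    {n : ℕ} (hn : 2 ≤ n) :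
    (1 + α) ^ p / (1 / p - 1 - α) *
        ((n : ℝ) ^ (-α * p) * (n - 1 / 5 + (1 / p - 1 - α)) ^ (1 - p)) ≤
      1 / (∑ i ∈ Finset.Icc 1 n, (i : ℝ) ^ α) ^ p +
        (1 + α) ^ p / (1 / p - 1 - α) *
          (((n : ℝ) - 1) ^ (-α * p) * (n - 1 - 1 / 5) ^ (1 - p)) := by
  have hP : 3 ≤ 1 / p := by
    rw [le_div_iff₀ hp]
    linarith
  have h1 : 0 < 1 + α := by linarith
  have hβ : 0 < 1 / p - 1 - α := by linarith
  have hn0 : (0 : ℝ) < n := by positivity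
  have h := rpow_mul_rpow_step hp hp' (by linarith : 0 ≤ -α)
    (by exact_mod_cast hn : (2 : ℝ) ≤ n)
  rw [show 1 / p - 1 + -α = 1 / p - 1 - α by ring] at h
  have hC : 0 ≤ (1 + α) ^ p / (1 / p - 1 - α) := by positivity
  have h2 := mul_le_mul_of_nonneg_left h hC
  have hΛ : 0 < ∑ i ∈ Finset.Icc 1 n, (i : ℝ) ^ α := by
    refine Finset.sum_pos (fun i hi => ?_) ⟨1, by simp; omega⟩
    have : 0 < i := (Finset.mem_Icc.1 hi).1
    positivity
  have h3 : (1 + α) ^ p * (n : ℝ) ^ (-α * p - p) ≤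
      1 / (∑ i ∈ Finset.Icc 1 n, (i : ℝ) ^ α) ^ p := by
    rw [le_div_iff₀ (by positivity)]
    have h4 := Real.rpow_le_rpow hΛ.le (sum_Icc_rpow_le hα hα' n) hp.le
    rw [Real.div_rpow (by positivity) h1.le, ← Real.rpow_mul hn0.le,
      le_div_iff₀ (by positivity)] at h4
    have h5 : (n : ℝ) ^ ((1 + α) * p) * (n : ℝ) ^ (-α * p - p) = 1 := by
      rw [← Real.rpow_add hn0, show (1 + α) * p + (-α * p - p) = 0 by ring, Real.rpow_zero]
    have h6 := mul_le_mul_of_nonneg_right h4 (by positivity : 0 ≤ (n : ℝ) ^ (-α * p - p))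
    linarith
  have h7 : (1 + α) ^ p / (1 / p - 1 - α) * ((1 / p - 1 - α) * (n : ℝ) ^ (-α * p - p)) =
      (1 + α) ^ p * (n : ℝ) ^ (-α * p - p) := by
    rw [← mul_assoc, div_mul_cancel₀ _ hβ.ne']
  linarith

/-- One term of the left-hand side, split by Hölder's inequality. -/
theorem term_step {p α a A A' : ℝ} (hp : 0 < p) (hp' : p ≤ 1 / 3) (hα : -1 < α) (hα' : α ≤ 0)
    {n : ℕ} (hn : 1 ≤ n) (ha : 0 ≤ a) (hA' : 0 ≤ A') (hA : A = (n : ℝ) ^ α * a + A') :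
    ((1 + α) * p / (1 - (1 + α) * p)) ^ p * a ^ p +
        (1 + α) ^ p / (1 / p - 1 - α) * ((n : ℝ) ^ (-α * p) * (n - 1 / 5) ^ (1 - p)) * A' ^ p ≤
      (1 + α) ^ p / (1 / p - 1 - α) *
        ((n : ℝ) ^ (-α * p) * (n - 1 / 5 + (1 / p - 1 - α)) ^ (1 - p)) * A ^ p := by
  have hP : 3 ≤ 1 / p := by
    rw [le_div_iff₀ hp]
    linarith
  have h1 : 0 < 1 + α := by linarith
  have hβ : 0 < 1 / p - 1 - α := by linarith
  have hn1 : (1 : ℝ) ≤ n := by exact_mod_cast hn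
  have hn0 : (0 : ℝ) < n := by linarith
  have h := rpow_mul_rpow_add_le (x := (n : ℝ) ^ α * a) hp (by linarith) (by positivity) hA' hβ
    (by linarith : (0 : ℝ) ≤ n - 1 / 5)
  rw [← hA, Real.mul_rpow (by positivity) ha, ← Real.rpow_mul hn0.le] at h
  have e1 : (1 + α) * p / (1 - (1 + α) * p) = (1 + α) / (1 / p - 1 - α) := by
    have : 1 - (1 + α) * p = p * (1 / p - 1 - α) := by
      field_simp
      ring
    rw [this, mul_comm (1 + α) p, mul_div_mul_left _ _ hp.ne']
  have e2 : (n : ℝ) ^ (-α * p) * (n : ℝ) ^ (α * p) = 1 := by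
    rw [← Real.rpow_add hn0, show -α * p + α * p = 0 by ring, Real.rpow_zero]
  have e3 : ((1 + α) / (1 / p - 1 - α)) ^ p =
      (1 + α) ^ p / (1 / p - 1 - α) * (1 / p - 1 - α) ^ (1 - p) := by
    rw [Real.div_rpow h1.le hβ.le, Real.rpow_sub hβ, Real.rpow_one, div_mul_div_comm,
      mul_comm (1 / p - 1 - α), mul_div_mul_right _ _ hβ.ne']
  rw [e1, e3, add_comm ((n : ℝ) - 1 / 5)]
  have h2 := mul_le_mul_of_nonneg_left h
    (by positivity : 0 ≤ (1 + α) ^ p / (1 / p - 1 - α) * (n : ℝ) ^ (-α * p))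
  refine le_trans (le_of_eq ?_) (h2.trans (le_of_eq ?_))
  · linear_combination (-((1 + α) ^ p / (1 / p - 1 - α) * (1 / p - 1 - α) ^ (1 - p) * a ^ p)) * e2
  · ring

/-- Finite form, for any nonnegative `A` with `A n = n ^ α * a n + A (n + 1)`. -/
theorem reversed_copson_sum_range {p α : ℝ} (hp : 0 < p) (hp' : p ≤ 1 / 3) (hα : -1 < α)
    (hα' : α ≤ 0) {a A : ℕ → ℝ} (ha : ∀ n, 1 ≤ n → 0 ≤ a n) (hA : ∀ n, 1 ≤ n → 0 ≤ A n)
    (hAa : ∀ n : ℕ, 1 ≤ n → A n = (n : ℝ) ^ α * a n + A (n + 1)) (N : ℕ) :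
    ((1 + α) * p / (1 - (1 + α) * p)) ^ p * ∑ n ∈ Finset.range (N + 1), a (n + 1) ^ p +
        (1 + α) ^ p / (1 / p - 1 - α) *
          (((N + 1 : ℕ) : ℝ) ^ (-α * p) * ((N + 1 : ℕ) - 1 / 5) ^ (1 - p)) * A (N + 2) ^ p ≤
      ∑ n ∈ Finset.range (N + 1),
        A (n + 1) ^ p / (∑ i ∈ Finset.Icc 1 (n + 1), (i : ℝ) ^ α) ^ p := by
  have hP : 3 ≤ 1 / p := by
    rw [le_div_iff₀ hp]
    linarith
  induction N with
  | zero =>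
    have h := term_step hp hp' hα hα' le_rfl (ha 1 le_rfl) (hA 2 (by norm_num)) (hAa 1 le_rfl)
    have h1 := rpow_add_le_base hp hp' (by linarith : 0 ≤ -α)
    have hβ : 0 < 1 / p - 1 - α := by linarith
    rw [show 1 / p - 1 + -α = 1 / p - 1 - α by ring] at h1
    have h2 : (1 + α) ^ p ≤ 1 := Real.rpow_le_one (by linarith) (by linarith) hp.le
    have h3 : (1 + α) ^ p / (1 / p - 1 - α) * (4 / 5 + (1 / p - 1 - α)) ^ (1 - p) ≤ 1 := by
      rw [div_mul_eq_mul_div, div_le_one hβ]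
      have h0 : 0 ≤ (4 / 5 + (1 / p - 1 - α)) ^ (1 - p) := by positivity
      nlinarith
    have h4 := mul_le_mul_of_nonneg_right h3 (Real.rpow_nonneg (hA 1 le_rfl) p)
    norm_num at h h4 ⊢
    linarith
  | succ N ih =>
    have h := term_step hp hp' hα hα' (by omega : 1 ≤ N + 2) (ha (N + 2) (by omega))
      (hA (N + 3) (by omega)) (hAa (N + 2) (by omega))
    have h1 := mul_le_mul_of_nonneg_right (weight_step hp hp' hα hα' (by omega : 2 ≤ N + 2))
      (Real.rpow_nonneg (hA (N + 2) (by omega)) p)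
    rw [Finset.sum_range_succ, Finset.sum_range_succ _ (N + 1), mul_add]
    have e : ((N + 2 : ℕ) : ℝ) - 1 = ((N + 1 : ℕ) : ℝ) := by
      push_cast
      ring
    rw [e, add_mul, one_div_mul_eq_div] at h1
    have := h.trans h1
    simp only [add_assoc, Nat.reduceAdd] at *
    linarith

/-- Theorem 2.1: reversed Copson-type inequality for `0 < p ≤ 1/3`, weights `n^α`,
`-1 < α ≤ 0`. The sums are taken in `ℝ≥0∞` since both sides may be infinite. -/
theorem stmt_5 (p α : ℝ) (hp : 0 < p) (hp' : p ≤ 1 / 3) (hα : -1 < α) (hα' : α ≤ 0)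
    (a : ℕ → ℝ) (ha : ∀ n, 1 ≤ n → 0 ≤ a n)
    (hsum : Summable fun k : ℕ => ((k + 1 : ℕ) : ℝ) ^ α * a (k + 1)) :
    ENNReal.ofReal (((1 + α) * p / (1 - (1 + α) * p)) ^ p) *
        ∑' n : ℕ, ENNReal.ofReal (a (n + 1) ^ p) ≤
      ∑' n : ℕ, ENNReal.ofReal
        ((∑' k : ℕ, ((n + 1 + k : ℕ) : ℝ) ^ α * a (n + 1 + k)) ^ p /
          (∑ i ∈ Finset.Icc 1 (n + 1), (i : ℝ) ^ α) ^ p) := by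
  set A : ℕ → ℝ := fun n => ∑' k : ℕ, ((n + k : ℕ) : ℝ) ^ α * a (n + k) with hAdef
  have hA : ∀ n, 1 ≤ n → 0 ≤ A n := fun n hn =>
    tsum_nonneg fun k => mul_nonneg (by positivity) (ha _ (by omega))
  have hAa : ∀ n : ℕ, 1 ≤ n → A n = (n : ℝ) ^ α * a n + A (n + 1) := by
    intro n hn
    have hs : Summable fun k : ℕ => ((n + k : ℕ) : ℝ) ^ α * a (n + k) := by
      have := (summable_nat_add_iff (n - 1)).2 hsum
      refine this.congr fun k => ?_
      rw [show k + (n - 1) + 1 = n + k by omega]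
    simp only [hAdef]
    rw [hs.tsum_eq_zero_add]
    simp only [add_zero]
    congr 1
    refine tsum_congr fun k => ?_
    rw [show n + (k + 1) = n + 1 + k by omega]
  have h1 : 0 < 1 + α := by linarith
  have h2 : 0 < 1 - (1 + α) * p := by nlinarith
  have hP : 3 ≤ 1 / p := by
    rw [le_div_iff₀ hp]
    linarith
  have hβ : 0 < 1 / p - 1 - α := by linarith
  have hC : 0 ≤ ((1 + α) * p / (1 - (1 + α) * p)) ^ p := by positivity
  rw [← ENNReal.tsum_mul_left]
  refine ENNReal.tsum_le_of_sum_range_le fun N => ?_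
  refine le_trans (Finset.sum_le_sum_of_subset (Finset.range_mono N.le_succ)) ?_
  refine le_trans ?_ (ENNReal.sum_le_tsum (Finset.range (N + 1)))
  have h := reversed_copson_sum_range hp hp' hα hα' ha hA hAa N
  simp only [← ENNReal.ofReal_mul hC]
  rw [← ENNReal.ofReal_sum_of_nonneg, ← ENNReal.ofReal_sum_of_nonneg, ← Finset.mul_sum]
  · refine ENNReal.ofReal_le_ofReal (le_trans (le_add_of_nonneg_right ?_) h)
    have h3 : (0 : ℝ) ≤ (N + 1 : ℕ) - 1 / 5 := by
      push_cast
      linarith [(Nat.cast_nonneg N : (0 : ℝ) ≤ N)]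
    have h4 := hA (N + 2) (by omega)
    positivity
  · intro n _
    have h4 := hA (n + 1) (by omega)
    positivity
  · intro n _
    exact mul_nonneg hC (Real.rpow_nonneg (ha _ (by omega)) p)
end

section
/- Let p ≥ 2 be a real number and let α be a real number with 1 ≤ α ≤ 2. Then for every nonnegative real sequence (a_n) with Σ_{n=1}^∞ a_n^p < ∞ one has Σ_{n=1}^∞ ( (Σ_{i=1}^n i^{α−1} a_i) / (Σ_{i=1}^n i^{α−1}) )^p ≤ ( αp/(αp−1) )^p · Σ_{n=1}^∞ a_n^p. -/
/-- Two-point Jensen inequality for `t ↦ t ^ p` in homogeneous form, with weights `c` and `v`. -/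
theorem rpow_mean_le_of_weights {p c v x B u : ℝ} (hp : 1 ≤ p) (hc : 0 < c) (hv : 0 ≤ v)
    (hx : 0 ≤ x) (hB : 0 ≤ B) (hu : u = x + v * B) :
    u ^ p * (c + v) ^ (1 - p) ≤ c ^ (1 - p) * x ^ p + v * B ^ p := by
  have hcv : 0 < c + v := by linarith
  have hu0 : 0 ≤ u := by rw [hu]; positivity
  have h := (convexOn_rpow hp).2 (Set.mem_Ici.2 (by positivity : 0 ≤ x / c)) (Set.mem_Ici.2 hB)
    (by positivity : 0 ≤ c / (c + v)) (by positivity : 0 ≤ v / (c + v)) (by field_simp)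
  simp only [smul_eq_mul] at h
  have e1 : c / (c + v) * (x / c) + v / (c + v) * B = u / (c + v) := by
    rw [hu]; field_simp
  rw [e1, Real.div_rpow hu0 hcv.le, Real.div_rpow hx hc.le] at h
  rw [Real.rpow_sub hcv, Real.rpow_sub hc, Real.rpow_one, Real.rpow_one]
  have h2 := mul_le_mul_of_nonneg_left h hcv.le
  have hcp := Real.rpow_pos_of_pos hc p
  calc u ^ p * ((c + v) / (c + v) ^ p) = (c + v) * (u ^ p / (c + v) ^ p) := by ring
    _ ≤ _ := h2
    _ = _ := by field_simp

/-- A sufficient condition for the weighted mean inequality, for partial sums. Here `l` is the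
weight sequence and `d = L / p`, where `L` is the parameter of Cartlidge's criterion. -/
theorem sum_weightedMean_rpow_le {p d : ℝ} (hp : 1 ≤ p) (hd : d < 1) (l x : ℕ → ℝ)
    (hl : ∀ n, 0 < l n) (hx : ∀ n, 0 ≤ x n)
    (hr : ∀ n, (∑ i ∈ Finset.range (n + 2), l i) / l (n + 1) - d ≤
      ((∑ i ∈ Finset.range (n + 1), l i) / l n) ^ p *
        ((∑ i ∈ Finset.range (n + 1), l i) / l n - d) ^ (1 - p)) (N : ℕ) :
    (1 - d) * ∑ n ∈ Finset.range N, ((∑ i ∈ Finset.range (n + 1), l i * x i) /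
        ∑ i ∈ Finset.range (n + 1), l i) ^ p +
      (∑ i ∈ Finset.range N, l i) / l N * ((∑ i ∈ Finset.range N, l i * x i) /
        ∑ i ∈ Finset.range N, l i) ^ p ≤
      (1 - d) ^ (1 - p) * ∑ n ∈ Finset.range N, x n ^ p := by
  induction N with
  | zero => simp
  | succ n ih =>
    have hlx : ∀ m, 0 ≤ ∑ i ∈ Finset.range m, l i * x i := fun m =>
      Finset.sum_nonneg fun i _ => mul_nonneg (hl i).le (hx i)
    have hS0 : ∀ m, 0 ≤ ∑ i ∈ Finset.range m, l i := fun m =>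
      Finset.sum_nonneg fun i _ => (hl i).le
    have hS : ∑ i ∈ Finset.range (n + 1), l i = (∑ i ∈ Finset.range n, l i) + l n :=
      Finset.sum_range_succ _ _
    have hS' : ∑ i ∈ Finset.range (n + 2), l i = (∑ i ∈ Finset.range (n + 1), l i) + l (n + 1) :=
      Finset.sum_range_succ _ _
    have hT : ∑ i ∈ Finset.range (n + 1), l i * x i =
        (∑ i ∈ Finset.range n, l i * x i) + l n * x n := Finset.sum_range_succ _ _
    have hTS : (∑ i ∈ Finset.range n, l i * x i) = (∑ i ∈ Finset.range n, l i) *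
        ((∑ i ∈ Finset.range n, l i * x i) / ∑ i ∈ Finset.range n, l i) := by
      rcases Nat.eq_zero_or_pos n with rfl | hn
      · simp
      · have : 0 < ∑ i ∈ Finset.range n, l i :=
          Finset.sum_pos (fun i _ => hl i) (by simpa using hn.ne')
        field_simp
    have hrn := hr n
    rw [Finset.sum_range_succ (fun n => x n ^ p) n,
      Finset.sum_range_succ (fun n => ((∑ i ∈ Finset.range (n + 1), l i * x i) /
        ∑ i ∈ Finset.range (n + 1), l i) ^ p) n]
    have hB := div_nonneg (hlx n) (hS0 n)
    have hA := div_nonneg (hlx (n + 1)) (hS0 (n + 1))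
    have hv := div_nonneg (hS0 n) (hl n).le
    have hSp : 0 < ∑ i ∈ Finset.range (n + 1), l i := by have := hS0 n; have := hl n; linarith
    set B := (∑ i ∈ Finset.range n, l i * x i) / ∑ i ∈ Finset.range n, l i
    set A := (∑ i ∈ Finset.range (n + 1), l i * x i) / ∑ i ∈ Finset.range (n + 1), l i with hAd
    set S := ∑ i ∈ Finset.range n, l i
    set S1 := ∑ i ∈ Finset.range (n + 1), l i
    have hln := hl n
    have hln1 := hl (n + 1)
    have hr1 : S1 / l n = 1 + S / l n := by rw [hS]; field_simp; ring
    have hu : S1 / l n * A = x n + S / l n * B := by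
      rw [hAd, hT, hTS]; field_simp; ring
    have hJ := rpow_mean_le_of_weights hp (sub_pos.2 hd) hv (hx n) hB hu
    rw [Real.mul_rpow (by positivity) hA, show 1 - d + S / l n = S1 / l n - d by
      rw [hr1]; ring] at hJ
    have hAp : 0 ≤ A ^ p := Real.rpow_nonneg hA p
    have h3 := mul_le_mul_of_nonneg_right hrn hAp
    have hr2 : (∑ i ∈ Finset.range (n + 2), l i) / l (n + 1) = 1 + S1 / l (n + 1) := by
      rw [hS']; field_simp; ring
    rw [hr2] at h3
    nlinarith [h3, hJ, ih]

/-- The lower half of the Levin–Stečkin bounds for power sums with exponent in `[0, 1]`. -/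
theorem mul_rpow_le_sum_range_rpow {s : ℝ} (hs : 0 ≤ s) (hs1 : s ≤ 1) (n : ℕ) :
    (n : ℝ) * ((n : ℝ) + 1) ^ s ≤ (s + 1) * ∑ i ∈ Finset.range n, ((i : ℝ) + 1) ^ s := by
  induction n with
  | zero => simp
  | succ n ih =>
    rw [Finset.sum_range_succ]
    push_cast
    have hn : (0 : ℝ) < n + 1 := by positivity
    have hb := rpow_one_add_le_one_add_mul_self (s := 1 / ((n : ℝ) + 1)) (p := s)
      (by have : 0 < 1 / ((n : ℝ) + 1) := by positivity
          linarith) hs hs1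
    have he : (n : ℝ) + 1 + 1 = (n + 1) * (1 + 1 / ((n : ℝ) + 1)) := by field_simp
    rw [he, Real.mul_rpow hn.le (by positivity)]
    have hpos := Real.rpow_pos_of_pos hn s
    have h2 : ((n : ℝ) + 1) * (1 + 1 / ((n : ℝ) + 1)) ^ s ≤ n + 1 + s := by
      calc _ ≤ ((n : ℝ) + 1) * (1 + s * (1 / ((n : ℝ) + 1))) := by gcongr
        _ = _ := by field_simp
    nlinarith [mul_le_mul_of_nonneg_right h2 hpos.le]

theorem sum_range_rpow_le_mul {s : ℝ} (hs : 0 ≤ s) (n : ℕ) :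
    ∑ i ∈ Finset.range n, ((i : ℝ) + 1) ^ s ≤ n * (n : ℝ) ^ s := by
  have h : ∀ i ∈ Finset.range n, ((i : ℝ) + 1) ^ s ≤ (n : ℝ) ^ s := fun i hi => by
    have : (i : ℝ) + 1 ≤ n := by exact_mod_cast Finset.mem_range.1 hi
    gcongr
  simpa using Finset.sum_le_sum h

/-- Second order Taylor lower bound for `(1 + x) ^ s` with `s ∈ [0, 1]`. -/
theorem quadratic_le_one_add_rpow {s x : ℝ} (hs : 0 ≤ s) (hs1 : s ≤ 1) (hx : 0 ≤ x) :
    1 + s * x - s * (1 - s) * x ^ 2 / 2 ≤ (1 + x) ^ s := by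
  have hder : ∀ y ∈ Set.Ici (0 : ℝ), HasDerivAt
      (fun y : ℝ => (1 + y) ^ s - (1 + s * y - s * (1 - s) * y ^ 2 / 2))
      (s * ((1 + y) ^ (s - 1) - (1 - (1 - s) * y))) y := fun y hy => by
    have hy : 0 ≤ y := hy
    have h1 := ((hasDerivAt_id y).const_add 1).rpow_const (p := s)
      (Or.inl (by simp only [id]; positivity))
    have h2 := (((hasDerivAt_id y).const_mul s).const_add 1).sub
      ((((hasDerivAt_id y).pow 2).const_mul (s * (1 - s))).div_const 2)
    refine (h1.sub h2).congr_deriv ?_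
    simp only [id]
    push_cast
    ring
  have hmono : MonotoneOn (fun y : ℝ => (1 + y) ^ s - (1 + s * y - s * (1 - s) * y ^ 2 / 2))
      (Set.Ici 0) := by
    refine monotoneOn_of_deriv_nonneg (convex_Ici 0)
      (fun y hy => (hder y hy).continuousAt.continuousWithinAt)
      (fun y hy => (hder y (interior_subset hy)).differentiableAt.differentiableWithinAt) ?_
    intro y hy
    rw [(hder y (interior_subset hy)).deriv]
    have hy : 0 ≤ y := interior_subset hy
    refine mul_nonneg hs (sub_nonneg.2 ?_)
    have hb := rpow_one_add_le_one_add_mul_self (s := y) (p := 1 - s)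
      (by linarith) (by linarith) (by linarith)
    have hpos : 0 < (1 + y) ^ (1 - s) := Real.rpow_pos_of_pos (by linarith) _
    rw [show s - 1 = -(1 - s) by ring, Real.rpow_neg (by linarith), ← one_div, le_div_iff₀ hpos]
    have h0 : 0 ≤ (1 - s) * y := mul_nonneg (by linarith) hy
    by_cases h : 0 ≤ 1 - (1 - s) * y
    · nlinarith [mul_le_mul_of_nonneg_left hb h]
    · nlinarith
  have h := hmono (Set.mem_Ici.2 le_rfl) (Set.mem_Ici.2 hx) hx
  simp only [add_zero, mul_zero, Real.one_rpow] at h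
  norm_num at h
  linarith

/-- Second order Taylor lower bound for `(1 - x) ^ (-q)`. -/
theorem quadratic_le_one_sub_rpow_neg {q x : ℝ} (hq : 0 ≤ q) (hx : 0 ≤ x) (hx1 : x < 1) :
    1 + q * x + q * (q + 1) * x ^ 2 / 2 ≤ (1 - x) ^ (-q) := by
  have hlog : x + x ^ 2 / 2 ≤ -Real.log (1 - x) := by
    have h := sum_le_hasSum (Finset.range 2) (fun i _ => by positivity)
      (Real.hasSum_pow_div_log_of_abs_lt_one (x := x) (by rwa [abs_of_nonneg hx]))
    norm_num [Finset.sum_range_succ] at h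
    linarith
  rw [Real.rpow_def_of_pos (by linarith)]
  have hz : 0 ≤ q * (x + x ^ 2 / 2) := by positivity
  calc 1 + q * x + q * (q + 1) * x ^ 2 / 2
      ≤ 1 + q * (x + x ^ 2 / 2) + (q * (x + x ^ 2 / 2)) ^ 2 / 2 := by
        have : 0 ≤ q ^ 2 * (x ^ 3 + x ^ 4 / 4) := by positivity
        nlinarith
    _ ≤ Real.exp (q * (x + x ^ 2 / 2)) := Real.quadratic_le_exp_of_nonneg hz
    _ ≤ _ := Real.exp_le_exp.2 (by nlinarith)

/-- Increment bound for the ratios `(∑ i ≤ n, i ^ s) / n ^ s`. -/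
theorem sum_range_rpow_div_succ_le {s : ℝ} (hs : 0 ≤ s) (hs1 : s ≤ 1) (n : ℕ) :
    (∑ i ∈ Finset.range (n + 2), ((i : ℝ) + 1) ^ s) / ((n : ℝ) + 1 + 1) ^ s ≤
      (∑ i ∈ Finset.range (n + 1), ((i : ℝ) + 1) ^ s) / ((n : ℝ) + 1) ^ s + 1 / (s + 1) +
        1 / (4 * (s + 1) ^ 2 *
          ((∑ i ∈ Finset.range (n + 1), ((i : ℝ) + 1) ^ s) / ((n : ℝ) + 1) ^ s)) := by
  have hlow := mul_rpow_le_sum_range_rpow hs hs1 (n + 1)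
  have hup := sum_range_rpow_le_mul hs (n + 1)
  rw [Finset.sum_range_succ _ (n + 1)]
  push_cast at hlow hup ⊢
  have hS : 0 < ∑ i ∈ Finset.range (n + 1), ((i : ℝ) + 1) ^ s :=
    Finset.sum_pos (fun i _ => by positivity) (by simp)
  set S := ∑ i ∈ Finset.range (n + 1), ((i : ℝ) + 1) ^ s
  have hm : (0 : ℝ) < n + 1 := by positivity
  set m : ℝ := n + 1
  have ht := quadratic_le_one_add_rpow hs hs1 (x := 1 / m) (by positivity)
  have he : (m + 1) ^ s = m ^ s * (1 + 1 / m) ^ s := by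
    rw [← Real.mul_rpow hm.le (by positivity)]; congr 1; field_simp
  have hms : 0 < m ^ s := by positivity
  have htp : 0 < (1 + 1 / m) ^ s := by positivity
  rw [he] at hlow ⊢
  set t := (1 + 1 / m) ^ s
  have hr : 0 < S / m ^ s := by positivity
  have hrl : m * t ≤ (s + 1) * (S / m ^ s) := by
    rw [← mul_div_assoc, le_div_iff₀ hms]; linarith
  have hru : S / m ^ s ≤ m := by rw [div_le_iff₀ hms]; exact hup
  have hlhs : (S + m ^ s * t) / (m ^ s * t) = S / m ^ s / t + 1 := by field_simp
  rw [hlhs]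
  set r := S / m ^ s
  have ht1 : 1 ≤ t := Real.one_le_rpow (by have : 0 < 1 / m := by positivity
                                           linarith) hs
  have h1 : m * (t - 1) / (s + 1) ≤ r - r / t := by
    have : r - r / t = r * (t - 1) / t := by field_simp
    rw [this, div_le_div_iff₀ (by linarith) htp]
    nlinarith [mul_le_mul_of_nonneg_right hrl (sub_nonneg.2 ht1)]
  have h2 : (s - s * (1 - s) / (2 * m)) / (s + 1) ≤ m * (t - 1) / (s + 1) := by
    gcongr
    have h := mul_le_mul_of_nonneg_left ht hm.le
    have e : m * (1 + s * (1 / m) - s * (1 - s) * (1 / m) ^ 2 / 2) =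
      m + s - s * (1 - s) / (2 * m) := by field_simp
    linarith
  have h3 : 1 / (4 * (s + 1) ^ 2 * m) ≤ 1 / (4 * (s + 1) ^ 2 * r) := by gcongr
  have h4 : 1 ≤ 1 / (s + 1) + (s - s * (1 - s) / (2 * m)) / (s + 1) +
      1 / (4 * (s + 1) ^ 2 * m) := by
    have e : 1 / (s + 1) + (s - s * (1 - s) / (2 * m)) / (s + 1) + 1 / (4 * (s + 1) ^ 2 * m) - 1 =
      (1 - 2 * (s * (1 - s ^ 2))) / (4 * (s + 1) ^ 2 * m) := by
      field_simp; ring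
    have : 0 ≤ (1 - 2 * (s * (1 - s ^ 2))) / (4 * (s + 1) ^ 2 * m) := by
      apply div_nonneg _ (by positivity)
      nlinarith [mul_nonneg hs (sq_nonneg (s - 3 / 5)), sq_nonneg (s - 3 / 5)]
    linarith
  linarith

/-- Power weights with exponent in `[0, 1]` satisfy the criterion of
`sum_weightedMean_rpow_le` for `p ≥ 2`. -/
theorem rpow_weights_ratio_le {p s : ℝ} (hp : 2 ≤ p) (hs : 0 ≤ s) (hs1 : s ≤ 1) (n : ℕ) :
    (∑ i ∈ Finset.range (n + 2), ((i : ℝ) + 1) ^ s) / ((n : ℝ) + 1 + 1) ^ s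
        - 1 / ((s + 1) * p) ≤
      ((∑ i ∈ Finset.range (n + 1), ((i : ℝ) + 1) ^ s) / ((n : ℝ) + 1) ^ s) ^ p *
        ((∑ i ∈ Finset.range (n + 1), ((i : ℝ) + 1) ^ s) / ((n : ℝ) + 1) ^ s
          - 1 / ((s + 1) * p)) ^ (1 - p) := by
  have h := sum_range_rpow_div_succ_le hs hs1 n
  have hr1 : 1 ≤ (∑ i ∈ Finset.range (n + 1), ((i : ℝ) + 1) ^ s) / ((n : ℝ) + 1) ^ s := by
    rw [one_le_div (by positivity)]
    exact Finset.single_le_sum (f := fun i : ℕ => ((i : ℝ) + 1) ^ s)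
      (fun i _ => by positivity) (Finset.self_mem_range_succ n)
  refine (sub_le_sub_right h _).trans ?_
  set r := (∑ i ∈ Finset.range (n + 1), ((i : ℝ) + 1) ^ s) / ((n : ℝ) + 1) ^ s
  have hr : 0 < r := by linarith
  have hd : 1 / ((s + 1) * p) < 1 := by
    rw [div_lt_one (by positivity)]; nlinarith
  have hx1 : 1 / ((s + 1) * p) / r < 1 := by rw [div_lt_one hr]; linarith
  have hq := quadratic_le_one_sub_rpow_neg (q := p - 1) (x := 1 / ((s + 1) * p) / r)
    (by linarith) (by positivity) hx1
  have e : r ^ p * (r - 1 / ((s + 1) * p)) ^ (1 - p) =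
      r * (1 - 1 / ((s + 1) * p) / r) ^ (-(p - 1)) := by
    have e1 : r - 1 / ((s + 1) * p) = r * (1 - 1 / ((s + 1) * p) / r) := by field_simp
    rw [e1, Real.mul_rpow hr.le (by linarith), ← mul_assoc, ← Real.rpow_add hr]
    simp
  rw [e]
  refine le_trans ?_ (mul_le_mul_of_nonneg_left hq hr.le)
  have e2 : r * (1 + (p - 1) * (1 / ((s + 1) * p) / r) +
      (p - 1) * (p - 1 + 1) * (1 / ((s + 1) * p) / r) ^ 2 / 2) -
      (r + 1 / (s + 1) + 1 / (4 * (s + 1) ^ 2 * r) - 1 / ((s + 1) * p)) =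
      (p - 2) / (4 * p * (s + 1) ^ 2 * r) := by
    field_simp; ring
  have : 0 ≤ (p - 2) / (4 * p * (s + 1) ^ 2 * r) := div_nonneg (by linarith) (by positivity)
  linarith


/-- Theorem 6.1: Bennett's inequality (8) for `p ≥ 2`, `1 ≤ α ≤ 2`. -/
theorem stmt_11 (p α : ℝ) (hp : 2 ≤ p) (hα : 1 ≤ α) (hα' : α ≤ 2)
    (a : ℕ → ℝ) (ha : ∀ n, 1 ≤ n → 0 ≤ a n)
    (hsum : Summable fun n : ℕ => a (n + 1) ^ p) :
    (Summable fun n : ℕ =>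
      ((∑ i ∈ Finset.Icc 1 (n + 1), (i : ℝ) ^ (α - 1) * a i) /
          (∑ i ∈ Finset.Icc 1 (n + 1), (i : ℝ) ^ (α - 1))) ^ p) ∧
    ∑' n : ℕ,
        ((∑ i ∈ Finset.Icc 1 (n + 1), (i : ℝ) ^ (α - 1) * a i) /
          (∑ i ∈ Finset.Icc 1 (n + 1), (i : ℝ) ^ (α - 1))) ^ p ≤
      (α * p / (α * p - 1)) ^ p * ∑' n : ℕ, a (n + 1) ^ p := by
  have hshift : ∀ (f : ℕ → ℝ) (n : ℕ), ∑ i ∈ Finset.Icc 1 (n + 1), f i =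
      ∑ i ∈ Finset.range (n + 1), f (i + 1) := fun f n => by
    rw [← Finset.Ico_add_one_right_eq_Icc, Finset.sum_Ico_eq_sum_range]
    simp [add_comm]
  simp only [hshift]
  push_cast
  have hs : 0 ≤ α - 1 := by linarith
  have hs1 : α - 1 ≤ 1 := by linarith
  have hx : ∀ n, 0 ≤ a (n + 1) := fun n => ha _ (by omega)
  have hd : 1 / (α * p) < 1 := by
    rw [div_lt_one (by positivity)]; nlinarith
  have hc : 0 < 1 - 1 / (α * p) := by linarith
  have hαp : 0 < α * p - 1 := by nlinarith
  have hconst : (α * p / (α * p - 1)) ^ p = (1 - 1 / (α * p)) ^ (1 - p) / (1 - 1 / (α * p)) := by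
    have e : α * p / (α * p - 1) = (1 - 1 / (α * p))⁻¹ := by
      have : α * p ≠ 0 := by positivity
      field_simp
    rw [e, Real.inv_rpow hc.le, Real.rpow_sub hc, Real.rpow_one]
    field_simp
  have hA : ∀ n : ℕ, 0 ≤ ((∑ i ∈ Finset.range (n + 1), ((i : ℝ) + 1) ^ (α - 1) * a (i + 1)) /
      ∑ i ∈ Finset.range (n + 1), ((i : ℝ) + 1) ^ (α - 1)) := fun n =>
    div_nonneg (Finset.sum_nonneg fun i _ => mul_nonneg (by positivity) (hx i))
      (Finset.sum_nonneg fun i _ => by positivity)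
  have hpart : ∀ N : ℕ, ∑ n ∈ Finset.range N,
      ((∑ i ∈ Finset.range (n + 1), ((i : ℝ) + 1) ^ (α - 1) * a (i + 1)) /
        ∑ i ∈ Finset.range (n + 1), ((i : ℝ) + 1) ^ (α - 1)) ^ p ≤
      (α * p / (α * p - 1)) ^ p * ∑' n : ℕ, a (n + 1) ^ p := fun N => by
    have hcrit := sum_weightedMean_rpow_le (by linarith : 1 ≤ p) hd
      (fun i : ℕ => ((i : ℝ) + 1) ^ (α - 1)) (fun i => a (i + 1)) (fun n => by positivity) hx
      (fun n => by simpa using rpow_weights_ratio_le hp hs hs1 n) N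
    have hrem : 0 ≤ (∑ i ∈ Finset.range N, ((i : ℝ) + 1) ^ (α - 1)) / ((N : ℝ) + 1) ^ (α - 1) *
        ((∑ i ∈ Finset.range N, ((i : ℝ) + 1) ^ (α - 1) * a (i + 1)) /
          ∑ i ∈ Finset.range N, ((i : ℝ) + 1) ^ (α - 1)) ^ p := by
      refine mul_nonneg (by positivity) (Real.rpow_nonneg (div_nonneg ?_ (by positivity)) _)
      exact Finset.sum_nonneg fun i _ => mul_nonneg (by positivity) (hx i)
    have hle : ∑ n ∈ Finset.range N, a (n + 1) ^ p ≤ ∑' n : ℕ, a (n + 1) ^ p :=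
      hsum.sum_le_tsum _ fun n _ => Real.rpow_nonneg (hx n) p
    have hle' := mul_le_mul_of_nonneg_left hle (Real.rpow_nonneg hc.le (1 - p))
    rw [hconst, div_mul_eq_mul_div, le_div_iff₀ hc]
    linarith
  exact ⟨summable_of_sum_range_le (fun n => Real.rpow_nonneg (hA n) p) hpart,
    Real.tsum_le_of_sum_range_le (fun n => Real.rpow_nonneg (hA n) p) hpart⟩
end

section
/- Let α > −1 be a real number and set λ_k = k^α and Λ_n = Σ_{k=1}^n k^α. Then for every nonnegative real sequence (a_n) with Σ_{n=1}^∞ a_n < ∞ one has Σ_{n=1}^∞ ( Π_{k=1}^n a_k^{k^α/Λ_n} ) ≤ e^{1/(α+1)} · Σ_{n=1}^∞ a_n. -/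
/-- Weighted Carleman inequality for finite sums, under a growth condition on the ratios
`Λ n / l n`. -/
theorem sum_weighted_geom_mean_le {l L a : ℕ → ℝ} {M : ℝ} (hl : ∀ n, 0 < l n)
    (hL : ∀ n, L n = ∑ k ∈ Finset.range (n + 1), l k) (ha : ∀ n, 0 ≤ a n)
    (hM : ∀ n, L (n + 1) / l (n + 1) ≤ L n / l n * Real.exp (M / (L n / l n))) (N : ℕ) :
    ∑ n ∈ Finset.range N, ∏ k ∈ Finset.range (n + 1), a k ^ (l k / L n) ≤
      Real.exp M * ∑ k ∈ Finset.range N, a k := by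
  have hLpos : ∀ n, 0 < L n := fun n ↦ by
    rw [hL]; exact Finset.sum_pos (fun k _ ↦ hl k) (by simp)
  have hLs : ∀ n, L (n + 1) = L n + l (n + 1) := fun n ↦ by
    rw [hL, hL, Finset.sum_range_succ]
  set R : ℕ → ℝ := fun n ↦ L n / l n with hR
  have hRpos : ∀ n, 0 < R n := fun n ↦ div_pos (hLpos n) (hl n)
  set c : ℕ → ℝ :=
    fun k ↦ Real.exp (Real.log (R k) + R k * (Real.log (R (k + 1)) - Real.log (R k))) with hc
  have hc_le : ∀ k, l k * c k ≤ Real.exp M * L k := by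
    intro k
    have h1 : Real.log (R (k + 1)) ≤ Real.log (R k) + M / R k := by
      rw [← Real.log_exp (M / R k), ← Real.log_mul (hRpos k).ne' (Real.exp_pos _).ne']
      exact Real.log_le_log (hRpos _) (hM k)
    have h2 : R k * (Real.log (R (k + 1)) - Real.log (R k)) ≤ M := by
      have := mul_le_mul_of_nonneg_left (sub_le_iff_le_add'.2 h1) (hRpos k).le
      rwa [mul_div_cancel₀ _ (hRpos k).ne'] at this
    have h3 : c k ≤ R k * Real.exp M := by
      rw [hc]
      simp only
      rw [Real.exp_add, Real.exp_log (hRpos k)]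
      gcongr
      exact (hRpos k).le
    calc l k * c k ≤ l k * (R k * Real.exp M) := by gcongr; exact (hl k).le
      _ = Real.exp M * L k := by
        simp only [hR]
        field_simp [(hl k).ne']
  have hlog : ∀ n, ∑ k ∈ Finset.range (n + 1), l k * Real.log (c k) =
      L n * Real.log (R (n + 1)) := by
    have hlR : ∀ k, l k * R k = L k := fun k ↦ mul_div_cancel₀ _ (hl k).ne'
    have hlc : ∀ k, l k * Real.log (c k) =
        l k * Real.log (R k) + L k * (Real.log (R (k + 1)) - Real.log (R k)) := fun k ↦ by
      rw [hc]
      simp only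
      rw [Real.log_exp, ← hlR k]
      ring
    intro n
    induction n with
    | zero =>
      have : L 0 = l 0 := by rw [hL]; simp
      rw [Finset.sum_range_one, hlc, this]
      ring
    | succ n ih => rw [Finset.sum_range_succ, ih, hlc, hLs]; ring
  have hprod : ∀ n, ∏ k ∈ Finset.range (n + 1), c k ^ (l k / L n) = R (n + 1) := by
    intro n
    have : ∀ k, c k ^ (l k / L n) = Real.exp (l k * Real.log (c k) / L n) := fun k ↦ by
      rw [Real.rpow_def_of_pos (show 0 < c k from Real.exp_pos _), mul_div_assoc', mul_comm (l k)]
    simp_rw [this]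
    rw [← Real.exp_sum, ← Finset.sum_div, hlog, mul_div_cancel_left₀ _ (hLpos n).ne',
      Real.exp_log (hRpos _)]
  have hterm : ∀ n, ∏ k ∈ Finset.range (n + 1), a k ^ (l k / L n) ≤
      Real.exp M * ((1 / L n - 1 / L (n + 1)) * ∑ k ∈ Finset.range (n + 1), L k * a k) := by
    intro n
    have hamgm := Real.geom_mean_le_arith_mean_weighted (Finset.range (n + 1))
      (fun k ↦ l k / L n) (fun k ↦ c k * a k) (fun k _ ↦ (div_pos (hl k) (hLpos n)).le)
      (by rw [← Finset.sum_div, ← hL, div_self (hLpos n).ne'])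
      (fun k _ ↦ mul_nonneg (Real.exp_pos _).le (ha k))
    have hsplit : ∏ k ∈ Finset.range (n + 1), (c k * a k) ^ (l k / L n) =
        R (n + 1) * ∏ k ∈ Finset.range (n + 1), a k ^ (l k / L n) := by
      rw [← hprod n, ← Finset.prod_mul_distrib]
      exact Finset.prod_congr rfl fun k _ ↦ Real.mul_rpow (Real.exp_pos _).le (ha k)
    rw [hsplit] at hamgm
    have hsum : ∑ k ∈ Finset.range (n + 1), l k / L n * (c k * a k) ≤
        Real.exp M / L n * ∑ k ∈ Finset.range (n + 1), L k * a k := by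
      rw [Finset.mul_sum]
      refine Finset.sum_le_sum fun k _ ↦ ?_
      calc l k / L n * (c k * a k) = l k * c k * (a k / L n) := by ring
        _ ≤ Real.exp M * L k * (a k / L n) :=
          mul_le_mul_of_nonneg_right (hc_le k) (div_nonneg (ha k) (hLpos n).le)
        _ = Real.exp M / L n * (L k * a k) := by ring
    have h := (le_div_iff₀' (hRpos (n + 1))).2 (hamgm.trans hsum)
    refine h.trans_eq ?_
    have hl' : l (n + 1) = L (n + 1) - L n := by rw [hLs]; ring
    have h1 := (hLpos n).ne'
    have h2 := (hLpos (n + 1)).ne'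
    have h3 := (hl (n + 1)).ne'
    have h4 : 1 / L n - 1 / L (n + 1) = l (n + 1) / (L n * L (n + 1)) := by
      rw [hl']; field_simp
    rw [h4]
    simp only [hR]
    field_simp
  have htel : ∑ n ∈ Finset.range N,
      (1 / L n - 1 / L (n + 1)) * ∑ k ∈ Finset.range (n + 1), L k * a k =
      ∑ k ∈ Finset.range N, a k - (∑ k ∈ Finset.range N, L k * a k) / L N := by
    induction N with
    | zero => simp
    | succ N ih =>
      rw [Finset.sum_range_succ, ih, Finset.sum_range_succ a, Finset.sum_range_succ _ N]
      have h1 := (hLpos N).ne'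
      have h2 := (hLpos (N + 1)).ne'
      field_simp
      ring
  calc _ ≤ ∑ n ∈ Finset.range N, Real.exp M *
        ((1 / L n - 1 / L (n + 1)) * ∑ k ∈ Finset.range (n + 1), L k * a k) :=
        Finset.sum_le_sum fun n _ ↦ hterm n
    _ ≤ _ := by
      rw [← Finset.mul_sum, htel]
      gcongr
      exact sub_le_self _ (div_nonneg
        (Finset.sum_nonneg fun k _ ↦ mul_nonneg (hLpos k).le (ha k)) (hLpos N).le)

theorem mul_sinh_le_sinh_mul {p u : ℝ} (hp : 1 ≤ p) (hu : 0 ≤ u) :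
    p * Real.sinh u ≤ Real.sinh (p * u) := by
  have hder : ∀ x, HasDerivAt (fun x ↦ Real.sinh (p * x) - p * Real.sinh x)
      (Real.cosh (p * x) * (p * 1) - p * Real.cosh x) x := fun x ↦
    (((hasDerivAt_id x).const_mul p).sinh).sub ((Real.hasDerivAt_sinh x).const_mul p)
  have hmono : MonotoneOn (fun x ↦ Real.sinh (p * x) - p * Real.sinh x) (Set.Ici 0) := by
    refine monotoneOn_of_deriv_nonneg (convex_Ici 0)
      (fun x _ ↦ (hder x).continuousAt.continuousWithinAt)
      (fun x _ ↦ (hder x).differentiableAt.differentiableWithinAt) fun x hx ↦ ?_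
    rw [interior_Ici, Set.mem_Ioi] at hx
    rw [(hder x).deriv]
    have : Real.cosh x ≤ Real.cosh (p * x) := by
      rw [Real.cosh_le_cosh, abs_of_pos hx, abs_of_pos (by positivity)]
      nlinarith
    nlinarith
  simpa using hmono Set.self_mem_Ici hu hu

theorem sq_mul_rpow_sub_one_mul_le {p t : ℝ} (hp : 1 ≤ p) (ht : 0 < t) (ht1 : t ≤ 1) :
    p ^ 2 * t ^ (p - 1) * (1 - t) ^ 2 ≤ (1 - t ^ p) ^ 2 := by
  set u : ℝ := -Real.log t / 2 with hu
  have hu0 : 0 ≤ u := by have := Real.log_nonpos ht.le ht1; rw [hu]; linarith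
  have hlog : Real.log t = -(2 * u) := by rw [hu]; ring
  have hsinh : ∀ q, 1 - t ^ q = 2 * Real.exp (-(q * u)) * Real.sinh (q * u) := fun q ↦ by
    rw [Real.rpow_def_of_pos ht, hlog, Real.sinh_eq,
      show -(2 * u) * q = -(q * u) + -(q * u) by ring, Real.exp_add, Real.exp_neg]
    field_simp [(Real.exp_pos (q * u)).ne']
  have h1 := hsinh 1
  rw [Real.rpow_one, one_mul] at h1
  have hexp : t ^ (p - 1) * Real.exp (-u) ^ 2 = Real.exp (-(p * u)) ^ 2 := by
    rw [Real.rpow_def_of_pos ht, hlog, ← Real.exp_nat_mul, ← Real.exp_nat_mul, ← Real.exp_add]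
    congr 1
    push_cast
    ring
  have hs : (p * Real.sinh u) ^ 2 ≤ Real.sinh (p * u) ^ 2 := by
    have := Real.sinh_nonneg_iff.2 hu0
    exact pow_le_pow_left₀ (by positivity) (mul_sinh_le_sinh_mul hp hu0) 2
  rw [hsinh p, h1]
  calc p ^ 2 * t ^ (p - 1) * (2 * Real.exp (-u) * Real.sinh u) ^ 2
      = 4 * (t ^ (p - 1) * Real.exp (-u) ^ 2) * (p * Real.sinh u) ^ 2 := by ring
    _ ≤ 4 * (t ^ (p - 1) * Real.exp (-u) ^ 2) * Real.sinh (p * u) ^ 2 := by gcongr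
    _ = _ := by rw [hexp]; ring

theorem antitoneOn_one_sub_div_rpow_inv {p : ℝ} (hp : 1 ≤ p) :
    AntitoneOn (fun x : ℝ ↦ (1 - (x / (x + 1)) ^ p)⁻¹ - x / p) (Set.Ici 1) := by
  have hpos : ∀ x : ℝ, 1 ≤ x → 0 < 1 - (x / (x + 1)) ^ p := fun x hx ↦ by
    have : (x / (x + 1)) ^ p < 1 :=
      Real.rpow_lt_one (by positivity) (by rw [div_lt_one (by positivity)]; linarith)
        (by linarith)
    linarith
  have hder : ∀ x : ℝ, 1 ≤ x → HasDerivAt (fun x : ℝ ↦ (1 - (x / (x + 1)) ^ p)⁻¹ - x / p)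
      (-(-((1 * (x + 1) - x * 1) / (x + 1) ^ 2 * p * (x / (x + 1)) ^ (p - 1))) /
        (1 - (x / (x + 1)) ^ p) ^ 2 - 1 / p) x := fun x hx ↦ by
    have h0 : x + 1 ≠ 0 := by linarith
    exact (((((hasDerivAt_id x).div ((hasDerivAt_id x).add_const 1) h0).rpow_const
      (Or.inr hp)).const_sub 1).inv (hpos x hx).ne').sub ((hasDerivAt_id x).div_const p)
  refine antitoneOn_of_deriv_nonpos (convex_Ici 1)
    (fun x hx ↦ (hder x hx).continuousAt.continuousWithinAt)
    (fun x hx ↦ (hder x (interior_subset hx)).differentiableAt.differentiableWithinAt)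
    fun x hx ↦ ?_
  have hx1 : 1 ≤ x := interior_subset hx
  rw [(hder x hx1).deriv, sub_nonpos, div_le_div_iff₀ (pow_pos (hpos x hx1) 2) (by linarith)]
  have h := sq_mul_rpow_sub_one_mul_le hp (t := x / (x + 1)) (by positivity)
    (by rw [div_le_one (by positivity)]; linarith)
  have h2 : 1 - x / (x + 1) = 1 / (x + 1) := by field_simp; ring
  rw [h2] at h
  refine le_trans (le_of_eq ?_) (h.trans_eq (one_mul _).symm)
  field_simp
  ring

/-- The ratios `Λ n / n ^ α`, characterised by their recursion, satisfy the growth condition of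
the weighted Carleman inequality when `-1 < α ≤ 0`. -/
theorem ratio_growth_of_nonpos {α : ℝ} (hα : -1 < α) (hα0 : α ≤ 0) {R : ℕ → ℝ} (h0 : R 0 = 1)
    (hR : ∀ k : ℕ, R (k + 1) = 1 + (((k : ℝ) + 1) / (k + 1 + 1)) ^ α * R k)
    (hpos : ∀ k, 0 < R k) (k : ℕ) :
    R (k + 1) ≤ R k * Real.exp (1 / (α + 1) / R k) := by
  have hα1 : 0 < α + 1 := by linarith
  have hq : ∀ y : ℝ, 0 < y → (y / (y + 1)) ^ α ≤ 1 - α / y := fun y hy ↦ by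
    have h1 : (y / (y + 1)) ^ α = (1 + 1 / y) ^ (-α) := by
      rw [Real.rpow_neg (by positivity), ← Real.inv_rpow (by positivity)]
      congr 1
      field_simp
    have h2 := rpow_one_add_le_one_add_mul_self (s := 1 / y) (p := -α)
      (by have : 0 < 1 / y := by positivity
          linarith) (by linarith) (by linarith)
    rw [h1]
    exact h2.trans_eq (by ring)
  have hub : ∀ k : ℕ, R k ≤ ((k : ℝ) + 1) / (α + 1) := by
    intro k
    induction k with
    | zero =>
      rw [h0, le_div_iff₀ hα1]
      push_cast
      linarith
    | succ k ih =>
      have hy : (0 : ℝ) < (k : ℝ) + 1 := by positivity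
      rw [hR]
      calc 1 + (((k : ℝ) + 1) / (k + 1 + 1)) ^ α * R k
          ≤ 1 + (1 - α / ((k : ℝ) + 1)) * (((k : ℝ) + 1) / (α + 1)) := by
            gcongr
            · exact (hpos k).le
            · exact sub_nonneg.2 ((div_nonpos_of_nonpos_of_nonneg hα0 hy.le).trans zero_le_one)
            · exact hq _ hy
        _ = _ := by
          push_cast
          field_simp
          ring
  have hy : (0 : ℝ) < (k : ℝ) + 1 := by positivity
  have hR0 := hpos k
  have hexp := Real.add_one_le_exp (1 / (α + 1) / R k)
  have hqk := hq _ hy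
  have hs : 1 / ((k : ℝ) + 1) ≤ 1 / (α + 1) / R k := by
    rw [div_div]
    refine one_div_le_one_div_of_le (by positivity) ?_
    have := (le_div_iff₀ hα1).1 (hub k)
    linarith
  have hs2 : 1 / R k = (α + 1) * (1 / (α + 1) / R k) := by field_simp
  rw [hR]
  set s := 1 / (α + 1) / R k
  have key : (((k : ℝ) + 1) / (k + 1 + 1)) ^ α + 1 / R k ≤ Real.exp s := by
    rw [hs2]
    have h3 : α / ((k : ℝ) + 1) = α * (1 / ((k : ℝ) + 1)) := by ring
    rw [h3] at hqk
    nlinarith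
  calc _ = R k * ((((k : ℝ) + 1) / (k + 1 + 1)) ^ α + 1 / R k) := by field_simp; ring
    _ ≤ _ := by gcongr

theorem ratio_growth_of_mem_Icc {α : ℝ} (hα0 : 0 ≤ α) (hα1 : α ≤ 1) {R : ℕ → ℝ} (h0 : R 0 = 1)
    (hR : ∀ k : ℕ, R (k + 1) = 1 + (((k : ℝ) + 1) / (k + 1 + 1)) ^ α * R k)
    (hpos : ∀ k, 0 < R k) (k : ℕ) :
    R (k + 1) ≤ R k * Real.exp (1 / (α + 1) / R k) := by
  have hlb : ∀ k : ℕ, ((k : ℝ) + 1 + α) / (α + 1) ≤ R k := by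
    intro k
    induction k with
    | zero =>
      rw [h0, div_le_one (by positivity)]
      push_cast
      linarith
    | succ k ih =>
      have hy : (0 : ℝ) < (k : ℝ) + 1 := by positivity
      have hq : ((k : ℝ) + 1) / (k + 1 + α) ≤ (((k : ℝ) + 1) / (k + 1 + 1)) ^ α := by
        have h1 : (((k : ℝ) + 1) / (k + 1 + 1)) ^ α = ((1 + 1 / ((k : ℝ) + 1)) ^ α)⁻¹ := by
          rw [← Real.inv_rpow (by positivity)]
          congr 1
          field_simp
        have h2 := rpow_one_add_le_one_add_mul_self (s := 1 / ((k : ℝ) + 1)) (p := α)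
          (by have : 0 < 1 / ((k : ℝ) + 1) := by positivity
              linarith) hα0 hα1
        have h3 : ((k : ℝ) + 1) / (k + 1 + α) = (1 + α * (1 / ((k : ℝ) + 1)))⁻¹ := by
          field_simp
        rw [h1, h3]
        exact inv_anti₀ (by positivity) h2
      rw [hR]
      calc ((k + 1 : ℕ) + 1 + α) / (α + 1)
          = 1 + ((k : ℝ) + 1) / (k + 1 + α) * (((k : ℝ) + 1 + α) / (α + 1)) := by
            push_cast
            field_simp
            ring
        _ ≤ _ := by gcongr
  have hR0 := hpos k
  have hexp := Real.quadratic_le_exp_of_nonneg (x := 1 / (α + 1) / R k) (by positivity)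
  have hs : 1 / (α + 1) / R k ≤ 1 / ((k : ℝ) + 1 + α) := by
    rw [div_div]
    refine one_div_le_one_div_of_le (by positivity) ?_
    have := (div_le_iff₀ (by positivity : 0 < α + 1)).1 (hlb k)
    linarith
  have hs0 : 0 ≤ 1 / (α + 1) / R k := by positivity
  have hs2 : 1 / R k = (α + 1) * (1 / (α + 1) / R k) := by field_simp
  have hq : (((k : ℝ) + 1) / (k + 1 + 1)) ^ α ≤ 1 - α / (k + 1 + 1) := by
    have h := rpow_one_add_le_one_add_mul_self (s := -(1 / ((k : ℝ) + 1 + 1))) (p := α)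
      (by rw [neg_le_neg_iff, div_le_one (by positivity)]
          linarith [(Nat.cast_nonneg k : (0 : ℝ) ≤ k)]) hα0 hα1
    have h1 : ((k : ℝ) + 1) / (k + 1 + 1) = 1 + -(1 / ((k : ℝ) + 1 + 1)) := by
      field_simp; ring
    rw [h1]
    exact h.trans_eq (by ring)
  rw [hR]
  set s := 1 / (α + 1) / R k
  set y : ℝ := (k : ℝ) + 1
  have hy : (1 : ℝ) ≤ y := by simp [y]
  have hquad : α * s - s ^ 2 / 2 ≤ α / (y + 1) := by
    rw [le_div_iff₀ (by positivity)]
    have hs' : s * (y + α) ≤ 1 := (le_div_iff₀ (by positivity)).1 hs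
    rcases le_total (s * (y + 1)) 1 with h | h
    · nlinarith [mul_le_mul_of_nonneg_left h hα0, mul_nonneg (sq_nonneg s) (by linarith : 0 ≤ y + 1)]
    · nlinarith [mul_le_mul_of_nonneg_left hs' hα0, mul_le_mul_of_nonneg_left h hs0,
        mul_nonneg hs0 (sq_nonneg (2 * α - 1))]
  have key : (y / (y + 1)) ^ α + 1 / R k ≤ Real.exp s := by
    rw [hs2]
    linarith
  calc _ = R k * ((y / (y + 1)) ^ α + 1 / R k) := by field_simp; ring
    _ ≤ _ := by gcongr

theorem ratio_growth_of_one_le {α : ℝ} (hα : 1 ≤ α) {R : ℕ → ℝ} (h0 : R 0 = 1)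
    (hR : ∀ k : ℕ, R (k + 1) = 1 + (((k : ℝ) + 1) / (k + 1 + 1)) ^ α * R k)
    (hpos : ∀ k, 0 < R k) (k : ℕ) :
    R (k + 1) ≤ R k * Real.exp (1 / (α + 1) / R k) := by
  have hα0 : 0 < α := by linarith
  have hq1 : ∀ k : ℕ, (((k : ℝ) + 1) / (k + 1 + 1)) ^ α < 1 := fun k ↦
    Real.rpow_lt_one (by positivity) (by rw [div_lt_one (by positivity)]; linarith) hα0
  have hlb : ∀ k : ℕ, α / (α + 1) ≤ (1 - (((k : ℝ) + 1) / (k + 1 + 1)) ^ α) * R k := by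
    intro k
    induction k with
    | zero =>
      have h2 := one_add_mul_self_le_rpow_one_add (s := 1) (by norm_num) hα
      have h3 : (((0 : ℕ) + 1 : ℝ) / ((0 : ℕ) + 1 + 1)) ^ α = ((1 + 1 : ℝ) ^ α)⁻¹ := by
        rw [← Real.inv_rpow (by norm_num)]
        norm_num
      have h4 := inv_anti₀ (by positivity) h2
      have h5 : α / (α + 1) = 1 - (1 + α * 1)⁻¹ := by field_simp; ring
      rw [h0, h3, h5]
      linarith
    | succ k ih =>
      have hanti := antitoneOn_one_sub_div_rpow_inv hα
        (show (k : ℝ) + 1 ∈ Set.Ici 1 by simp)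
        (show (k : ℝ) + 1 + 1 ∈ Set.Ici 1 by
          rw [Set.mem_Ici]; linarith [(Nat.cast_nonneg k : (0 : ℝ) ≤ k)])
        (by linarith)
      have hqk := hq1 k
      have hqk' := hq1 (k + 1)
      have hRk := hR k
      push_cast at hqk' ⊢
      simp only at hanti
      set q := (((k : ℝ) + 1) / (k + 1 + 1)) ^ α
      set q' := (((k : ℝ) + 1 + 1) / (k + 1 + 1 + 1)) ^ α
      have hRlb : α / (α + 1) * (1 - q)⁻¹ ≤ R k := by
        rw [← div_eq_mul_inv, div_le_iff₀' (by linarith)]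
        exact ih
      have hstep : (1 - q')⁻¹ ≤ (1 - q)⁻¹ + 1 / α := by
        have : ((k : ℝ) + 1 + 1) / α = ((k : ℝ) + 1) / α + 1 / α := by ring
        linarith
      have hq0 : 0 ≤ q := by positivity
      have hfin : α / (α + 1) * (1 - q')⁻¹ ≤ R (k + 1) := by
        calc α / (α + 1) * (1 - q')⁻¹ ≤ α / (α + 1) * ((1 - q)⁻¹ + 1 / α) := by gcongr
          _ = 1 + q * (α / (α + 1) * (1 - q)⁻¹) := by
            have : 1 - q ≠ 0 := by linarith
            field_simp
            ring
          _ ≤ R (k + 1) := by rw [hRk]; gcongr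
      rwa [← div_eq_mul_inv, div_le_iff₀' (by linarith)] at hfin
  have hexp := mul_le_mul_of_nonneg_left (Real.add_one_le_exp (1 / (α + 1) / R k)) (hpos k).le
  have h1 : R k * (1 / (α + 1) / R k + 1) = 1 - α / (α + 1) + R k := by
    have := (hpos k).ne'
    field_simp
    ring
  rw [h1] at hexp
  rw [hR]
  linarith [hlb k]

/-- Theorem 6.4: Bennett's conjecture, the weighted Carleman inequality with weights
`k^α` and constant `e^{1/(α+1)}`, for all `α > -1`. -/
theorem stmt_14 (α : ℝ) (hα : -1 < α)
    (a : ℕ → ℝ) (ha : ∀ n, 1 ≤ n → 0 ≤ a n)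
    (hsum : Summable fun n : ℕ => a (n + 1)) :
    (Summable fun n : ℕ =>
      ∏ k ∈ Finset.Icc 1 (n + 1),
        a k ^ ((k : ℝ) ^ α / ∑ i ∈ Finset.Icc 1 (n + 1), (i : ℝ) ^ α)) ∧
    ∑' n : ℕ,
        ∏ k ∈ Finset.Icc 1 (n + 1),
          a k ^ ((k : ℝ) ^ α / ∑ i ∈ Finset.Icc 1 (n + 1), (i : ℝ) ^ α) ≤
      Real.exp (1 / (α + 1)) * ∑' n : ℕ, a (n + 1) := by
  set l : ℕ → ℝ := fun k ↦ ((k : ℝ) + 1) ^ α with hl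
  set L : ℕ → ℝ := fun n ↦ ∑ k ∈ Finset.range (n + 1), l k with hL
  have hlpos : ∀ n, 0 < l n := fun n ↦ by positivity
  have hLpos : ∀ n, 0 < L n := fun n ↦ Finset.sum_pos (fun k _ ↦ hlpos k) (by simp)
  have hLeq : ∀ n : ℕ, ∑ i ∈ Finset.Icc 1 (n + 1), (i : ℝ) ^ α = L n := fun n ↦ by
    rw [← Finset.Ico_add_one_right_eq_Icc, Finset.sum_Ico_eq_sum_range]
    simp [hL, hl, add_comm]
  have hterm : ∀ n : ℕ, ∏ k ∈ Finset.Icc 1 (n + 1),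
      a k ^ ((k : ℝ) ^ α / ∑ i ∈ Finset.Icc 1 (n + 1), (i : ℝ) ^ α) =
      ∏ k ∈ Finset.range (n + 1), a (k + 1) ^ (l k / L n) := fun n ↦ by
    rw [hLeq, ← Finset.Ico_add_one_right_eq_Icc, Finset.prod_Ico_eq_prod_range]
    simp [hl, add_comm]
  simp_rw [hterm]
  have ha' : ∀ n, 0 ≤ a (n + 1) := fun n ↦ ha _ (by simp)
  have h0 : L 0 / l 0 = 1 := by simp [hL, hl]
  have hrec : ∀ k : ℕ, L (k + 1) / l (k + 1) =
      1 + (((k : ℝ) + 1) / (k + 1 + 1)) ^ α * (L k / l k) := fun k ↦ by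
    have h1 : L (k + 1) = L k + l (k + 1) := Finset.sum_range_succ _ _
    have h2 : (((k : ℝ) + 1) / (k + 1 + 1)) ^ α = l k / l (k + 1) := by
      rw [Real.div_rpow (by positivity) (by positivity)]
      simp [hl]
    have h3 := (hlpos k).ne'
    have h4 := (hlpos (k + 1)).ne'
    rw [h1, h2]
    field_simp
    ring
  have hpos : ∀ k, 0 < L k / l k := fun k ↦ div_pos (hLpos k) (hlpos k)
  have hgrowth : ∀ n, L (n + 1) / l (n + 1) ≤
      L n / l n * Real.exp (1 / (α + 1) / (L n / l n)) := by
    rcases le_total α 0 with h | h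
    · exact ratio_growth_of_nonpos (R := fun n ↦ L n / l n) hα h h0 hrec hpos
    rcases le_total α 1 with h' | h'
    · exact ratio_growth_of_mem_Icc (R := fun n ↦ L n / l n) h h' h0 hrec hpos
    · exact ratio_growth_of_one_le (R := fun n ↦ L n / l n) h' h0 hrec hpos
  have hbound : ∀ N, ∑ n ∈ Finset.range N,
      ∏ k ∈ Finset.range (n + 1), a (k + 1) ^ (l k / L n) ≤
      Real.exp (1 / (α + 1)) * ∑' n : ℕ, a (n + 1) := fun N ↦
    (sum_weighted_geom_mean_le hlpos (fun _ ↦ rfl) ha' hgrowth N).trans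
      (mul_le_mul_of_nonneg_left (hsum.sum_le_tsum _ fun n _ ↦ ha' n) (Real.exp_pos _).le)
  have hnonneg : ∀ n, 0 ≤ ∏ k ∈ Finset.range (n + 1), a (k + 1) ^ (l k / L n) := fun n ↦
    Finset.prod_nonneg fun k _ ↦ Real.rpow_nonneg (ha' k) _
  exact ⟨summable_of_sum_range_le hnonneg hbound, Real.tsum_le_of_sum_range_le hnonneg hbound⟩
end

section
/- Let p and L be real numbers with 0 < p ≤ 1/3 and L ≥ 1. Then for every real number x ≥ 1 one has (1 + (L/p − 2)/x)^{1/(1−p)} − (1 + L/x)^{−p/(1−p)} · (1 + (L−1)/x)^{(1+p)/(1−p)} ≥ (L − p)/(px). -/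
open Real in
/-- The `[1/1]` Padé approximant at `0` is a lower bound for `(1 + v) ^ a` when `v ≥ 0`. -/
lemma pade_le_one_add_rpow {a v : ℝ} (ha : 0 ≤ a) (ha' : a < 1) (hv : 0 ≤ v) :
    (2 + (1 + a) * v) / (2 + (1 - a) * v) ≤ (1 + v) ^ a := by
  have hN : ∀ u : ℝ, 0 ≤ u → 0 < 2 + (1 + a) * u := fun u hu => by positivity
  have hD : ∀ u : ℝ, 0 ≤ u → 0 < 2 + (1 - a) * u := fun u hu => by
    have := mul_nonneg (sub_nonneg.2 ha'.le) hu
    linarith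
  let g : ℝ → ℝ := fun u => a * log (1 + u) - log (2 + (1 + a) * u) + log (2 + (1 - a) * u)
  have hg : ∀ u : ℝ, 0 ≤ u → HasDerivAt g
      (a * (1 / (1 + u)) - (1 + a) / (2 + (1 + a) * u) + (1 - a) / (2 + (1 - a) * u)) u := by
    intro u hu
    have h1 : HasDerivAt (fun u : ℝ => 1 + u) 1 u := (hasDerivAt_id u).const_add 1
    have h2 : ∀ b : ℝ, HasDerivAt (fun u : ℝ => 2 + b * u) b u := fun b => by
      simpa using ((hasDerivAt_id u).const_mul b).const_add 2
    exact (((h1.log (by positivity)).const_mul a).sub ((h2 _).log (hN u hu).ne')).add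
      ((h2 _).log (hD u hu).ne')
  have hmono : MonotoneOn g (Set.Ici 0) := by
    refine monotoneOn_of_deriv_nonneg (convex_Ici 0)
      (fun u hu => (hg u hu).continuousAt.continuousWithinAt) ?_ ?_
    · intro u hu
      rw [interior_Ici] at hu
      exact (hg u (le_of_lt hu)).differentiableAt.differentiableWithinAt
    · intro u hu
      rw [interior_Ici] at hu
      have hu' : 0 ≤ u := le_of_lt hu
      rw [(hg u hu').deriv]
      have h1 := hN u hu'
      have h2 := hD u hu'
      have h3 : 0 < 1 + u := by positivity
      have : a * (1 / (1 + u)) - (1 + a) / (2 + (1 + a) * u) + (1 - a) / (2 + (1 - a) * u) =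
          a * ((1 - a) * (1 + a) * u ^ 2) /
            ((1 + u) * (2 + (1 + a) * u) * (2 + (1 - a) * u)) := by
        generalize hd : 2 + (1 - a) * u = d at h2 ⊢
        field_simp
        rw [← hd]
        ring
      rw [this]
      have := sub_nonneg.2 ha'.le
      positivity
  have h0 : g 0 ≤ g v := hmono (Set.mem_Ici.2 le_rfl) hv hv
  have hlog : log ((2 + (1 + a) * v) / (2 + (1 - a) * v)) ≤ a * log (1 + v) := by
    rw [log_div (hN v hv).ne' (hD v hv).ne']
    simp only [g, mul_zero, add_zero, log_one] at h0
    linarith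
  have hv1 : 0 < 1 + v := by positivity
  rw [rpow_def_of_pos hv1, mul_comm (log _)]
  exact (log_le_iff_le_exp (div_pos (hN v hv) (hD v hv))).1 hlog

/-- Bernoulli's inequality for exponents in `[0, 1]`, centred at `1`. -/
lemma rpow_le_one_add_mul_sub_one {y a : ℝ} (hy : 0 ≤ y) (ha : 0 ≤ a) (ha' : a ≤ 1) :
    y ^ a ≤ 1 + a * (y - 1) := by
  have := rpow_one_add_le_one_add_mul_self (s := y - 1) (by linarith) ha ha'
  simpa using this

lemma pade_poly_nonneg_of_three_halves_le {k L x : ℝ} (hk : 2 ≤ k) (hL : 3 / 2 ≤ L)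
    (hx : 1 ≤ x) :
    (k * L + L - 1) * k * (x + k * L + L - 2) * (x + L) *
        (2 * k * x + (k - 1) * (k * L + L - 2)) ≤
      (2 * k * x + (k + 1) * (k * L + L - 2)) *
        ((k * L - 1) * k * (x + k * L + L - 2) * (x + L) +
          (x + L - 1) * (k * L * x + k * L ^ 2 - 1)) := by
  obtain ⟨c, rfl⟩ : ∃ c, k = c + 2 := ⟨k - 2, by ring⟩
  obtain ⟨l, rfl⟩ : ∃ l, L = l + 3 / 2 := ⟨L - 3 / 2, by ring⟩
  obtain ⟨y, rfl⟩ : ∃ y, x = y + 1 := ⟨x - 1, by ring⟩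
  have hc : 0 ≤ c := by linarith
  have hl : 0 ≤ l := by linarith
  have hy : 0 ≤ y := by linarith
  rw [← sub_nonneg]
  ring_nf
  positivity

lemma pade_poly_nonneg_of_le_two {k L x : ℝ} (hk : 2 ≤ k) (hL : 1 ≤ L) (hL' : L ≤ 2)
    (hx : 1 ≤ x) :
    (x + L - 1) * (k * x + 2 * (L - 1)) * (k * (x + L) + k * L - 2) *
          (2 * k * x + (k - 1) * (k * L + L - 2)) ^ 2 +
        k ^ 2 * (x + L) * (k * L + L - 1) * (2 * k * x + (k + 1) * (k * L + L - 2)) *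
          (2 * k * x + (k - 1) * (k * L + L - 2)) * x ≤
      (2 * k * x + (k + 1) * (k * L + L - 2)) ^ 2 * k ^ 2 * (x + k * L + L - 2) * (x + L) * x := by
  obtain ⟨c, rfl⟩ : ∃ c, k = c + 2 := ⟨k - 2, by ring⟩
  obtain ⟨l, rfl⟩ : ∃ l, L = l + 1 := ⟨L - 1, by ring⟩
  obtain ⟨y, rfl⟩ : ∃ y, x = y + 1 := ⟨x - 1, by ring⟩
  have hc : 0 ≤ c := by linarith
  have hl : 0 ≤ l := by linarith
  have hl' : l ≤ 1 := by linarith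
  have hy : 0 ≤ y := by linarith
  have h4 : 0 ≤ (l ^ 3 - l ^ 4) * (10 * c ^ 5 + 80 * c ^ 4 + 212 * c ^ 3 + 160 * c ^ 2) :=
    mul_nonneg (sub_nonneg.2 (pow_le_pow_of_le_one hl hl' (by norm_num))) (by positivity)
  have h5 : 0 ≤ (l ^ 3 - l ^ 5) *
      (4 * c ^ 5 + 40 * c ^ 4 + 152 * c ^ 3 + 272 * c ^ 2 + 228 * c + 72) :=
    mul_nonneg (sub_nonneg.2 (pow_le_pow_of_le_one hl hl' (by norm_num))) (by positivity)
  rw [← sub_nonneg]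
  refine le_trans (add_nonneg h4 h5) ?_
  rw [← sub_nonneg]
  ring_nf
  positivity

lemma copson_core_of_three_halves_le {k L x s E : ℝ} (hk : 2 ≤ k) (hL : 3 / 2 ≤ L) (hx : 1 ≤ x)
    (hs : (2 * k * x + (k + 1) * (k * L + L - 2)) / (2 * k * x + (k - 1) * (k * L + L - 2)) ≤ s)
    (hE : E ≤ s * (1 + 1 / k * ((1 + (L - 1) / x) ^ 2 / (1 + L / x) /
      (1 + (k * L + L - 2) / x) - 1))) :
    (k * L + L - 1) / x ≤ (1 + (k * L + L - 2) / x) * s - (1 + (L - 1) / x) * E := by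
  have hkL : 3 ≤ k * L := by nlinarith
  have hA : 0 < x + k * L + L - 2 := by linarith
  have hD : 0 < 2 * k * x + (k - 1) * (k * L + L - 2) := by
    have : 0 < (k - 1) * (k * L + L - 2) := mul_pos (by linarith) (by linarith)
    positivity
  have hC : 0 ≤ 1 + (L - 1) / x := by
    have : 0 ≤ L - 1 := by linarith
    positivity
  have hB : 0 < x + L := by linarith
  set M := ((k * L - 1) * k * (x + k * L + L - 2) * (x + L) +
    (x + L - 1) * (k * L * x + k * L ^ 2 - 1)) / (k * x * (x + k * L + L - 2) * (x + L)) with hM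
  have hM0 : 0 ≤ M := by
    have h1 : 0 ≤ k * L - 1 := by linarith
    have h2 : 0 ≤ x + L - 1 := by linarith
    have h3 : 0 ≤ k * L * x + k * L ^ 2 - 1 := by nlinarith
    positivity
  have hid : (1 + (k * L + L - 2) / x) - (1 + (L - 1) / x) *
      (1 + 1 / k * ((1 + (L - 1) / x) ^ 2 / (1 + L / x) /
        (1 + (k * L + L - 2) / x) - 1)) = M := by
    have e1 : 1 + (k * L + L - 2) / x = (x + k * L + L - 2) / x := by field_simp; ring
    have e2 : 1 + L / x = (x + L) / x := by field_simp
    have e3 : 1 + (L - 1) / x = (x + L - 1) / x := by field_simp; ring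
    rw [hM, e1, e2, e3]
    have := hA.ne'
    field_simp
    ring
  have h1 : (k * L + L - 1) / x ≤ (2 * k * x + (k + 1) * (k * L + L - 2)) /
      (2 * k * x + (k - 1) * (k * L + L - 2)) * M := by
    rw [hM, div_mul_div_comm, div_le_div_iff₀ (by positivity) (by positivity)]
    have := mul_le_mul_of_nonneg_right (pade_poly_nonneg_of_three_halves_le hk hL hx)
      (by linarith : (0 : ℝ) ≤ x)
    linarith
  have h2 := mul_le_mul_of_nonneg_right hs hM0
  have h3 := mul_le_mul_of_nonneg_left hE hC
  rw [← hid] at h1 h2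
  linarith

lemma copson_core_of_le_two {k L x s E : ℝ} (hk : 2 ≤ k) (hL : 1 ≤ L) (hL' : L ≤ 2) (hx : 1 ≤ x)
    (hs1 : 1 ≤ s)
    (hs : (2 * k * x + (k + 1) * (k * L + L - 2)) / (2 * k * x + (k - 1) * (k * L + L - 2)) ≤ s)
    (hE : E * s ≤ (1 + 2 / k * ((L - 1) / x)) *
      (1 + 1 / k * ((1 + (k * L + L - 2) / x) / (1 + L / x) - 1))) :
    (k * L + L - 1) / x ≤ (1 + (k * L + L - 2) / x) * s - (1 + (L - 1) / x) * E := by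
  have hkL : 2 ≤ k * L := by nlinarith
  have hA : 0 < x + k * L + L - 2 := by linarith
  have hv : 0 < k * L + L - 2 := by linarith
  have hD : 0 < 2 * k * x + (k - 1) * (k * L + L - 2) := by
    have : 0 < (k - 1) * (k * L + L - 2) := mul_pos (by linarith) hv
    positivity
  have hC : 0 ≤ 1 + (L - 1) / x := by
    have : 0 ≤ L - 1 := by linarith
    positivity
  have hB : 0 < x + L := by linarith
  set r := (2 * k * x + (k + 1) * (k * L + L - 2)) /
    (2 * k * x + (k - 1) * (k * L + L - 2)) with hr
  have hr0 : 0 ≤ r := by positivity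
  have e1 : 1 + (k * L + L - 2) / x = (x + k * L + L - 2) / x := by field_simp; ring
  have e2 : 1 + L / x = (x + L) / x := by field_simp
  have e3 : 1 + (L - 1) / x = (x + L - 1) / x := by field_simp; ring
  have hpoly : (1 + (L - 1) / x) * ((1 + 2 / k * ((L - 1) / x)) *
      (1 + 1 / k * ((1 + (k * L + L - 2) / x) / (1 + L / x) - 1))) +
      (k * L + L - 1) / x * r ≤ (1 + (k * L + L - 2) / x) * r ^ 2 := by
    have hid : (1 + (k * L + L - 2) / x) * r ^ 2 - ((1 + (L - 1) / x) *
        ((1 + 2 / k * ((L - 1) / x)) *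
          (1 + 1 / k * ((1 + (k * L + L - 2) / x) / (1 + L / x) - 1))) +
        (k * L + L - 1) / x * r) =
        ((2 * k * x + (k + 1) * (k * L + L - 2)) ^ 2 * k ^ 2 * (x + k * L + L - 2) * (x + L) * x -
        ((x + L - 1) * (k * x + 2 * (L - 1)) * (k * (x + L) + k * L - 2) *
          (2 * k * x + (k - 1) * (k * L + L - 2)) ^ 2 +
        k ^ 2 * (x + L) * (k * L + L - 1) * (2 * k * x + (k + 1) * (k * L + L - 2)) *
          (2 * k * x + (k - 1) * (k * L + L - 2)) * x)) /
        (k ^ 2 * (x + L) * x ^ 2 * (2 * k * x + (k - 1) * (k * L + L - 2)) ^ 2) := by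
      rw [hr, e1, e2, e3]
      generalize 2 * k * x + (k - 1) * (k * L + L - 2) = d at hD ⊢
      field_simp
      ring
    rw [← sub_nonneg, hid]
    exact div_nonneg (sub_nonneg.2 (pade_poly_nonneg_of_le_two hk hL hL' hx)) (by positivity)
  have hR : (k * L + L - 1) / x ≤ 1 + (k * L + L - 2) / x := by
    rw [e1]
    exact div_le_div_of_nonneg_right (by linarith) (by linarith)
  have hA1 : 0 ≤ 1 + (k * L + L - 2) / x := by positivity
  have hincr : 0 ≤ (s - r) * ((1 + (k * L + L - 2) / x) * (s + r) - (k * L + L - 1) / x) := by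
    refine mul_nonneg (sub_nonneg.2 hs) ?_
    have := mul_le_mul_of_nonneg_left (by linarith : 1 ≤ s + r) hA1
    linarith
  have h3 := mul_le_mul_of_nonneg_left hE hC
  refine le_of_mul_le_mul_right ?_ (by linarith : 0 < s)
  linarith

lemma copson_core {k L x : ℝ} (hk : 2 ≤ k) (hL : 1 ≤ L) (hx : 1 ≤ x) :
    (k * L + L - 1) / x ≤ (1 + (k * L + L - 2) / x) * (1 + (k * L + L - 2) / x) ^ (1 / k) -
      (1 + (L - 1) / x) * ((1 + (L - 1) / x) ^ 2 / (1 + L / x)) ^ (1 / k) := by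
  have hk0 : 0 < k := by linarith
  have hx0 : 0 < x := by linarith
  have hv : 0 < k * L + L - 2 := by nlinarith
  have hL1 : 0 ≤ L - 1 := by linarith
  have hA : 0 < 1 + (k * L + L - 2) / x := by positivity
  have hB : 0 < 1 + L / x := by positivity
  have hC : 0 < 1 + (L - 1) / x := by positivity
  have ha : 0 ≤ 1 / k := by positivity
  have ha2 : 2 * (1 / k) ≤ 1 := by rw [mul_one_div, div_le_one hk0]; exact hk
  have hD : 0 < 2 * k * x + (k - 1) * (k * L + L - 2) := by
    have : 0 < (k - 1) * (k * L + L - 2) := mul_pos (by linarith) hv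
    positivity
  have hs : (2 * k * x + (k + 1) * (k * L + L - 2)) / (2 * k * x + (k - 1) * (k * L + L - 2)) ≤
      (1 + (k * L + L - 2) / x) ^ (1 / k) := by
    convert pade_le_one_add_rpow ha (by linarith) (div_pos hv hx0).le using 1
    have e1 : 2 + (1 + 1 / k) * ((k * L + L - 2) / x) =
        (2 * k * x + (k + 1) * (k * L + L - 2)) / (k * x) := by field_simp
    have e2 : 2 + (1 - 1 / k) * ((k * L + L - 2) / x) =
        (2 * k * x + (k - 1) * (k * L + L - 2)) / (k * x) := by field_simp
    rw [e1, e2, div_div_div_cancel_right₀ (by positivity)]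
  rcases le_total L 2 with h | h
  · refine copson_core_of_le_two hk hL h hx ?_ hs ?_
    · exact Real.one_le_rpow (by linarith [div_pos hv hx0]) ha
    · rw [← Real.mul_rpow (by positivity) hA.le, div_mul_eq_mul_div, mul_div_assoc,
        Real.mul_rpow (by positivity) (by positivity), ← Real.rpow_natCast_mul hC.le]
      refine mul_le_mul ?_ (rpow_le_one_add_mul_sub_one (by positivity) ha (by linarith))
        (by positivity) (by positivity)
      refine (rpow_le_one_add_mul_sub_one hC.le (by positivity) (by simpa using ha2)).trans_eq ?_
      push_cast
      ring
  · refine copson_core_of_three_halves_le hk (by linarith) hx hs ?_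
    have := rpow_le_one_add_mul_sub_one
      (y := (1 + (L - 1) / x) ^ 2 / (1 + L / x) / (1 + (k * L + L - 2) / x)) (a := 1 / k)
      (by positivity) ha (by linarith)
    rw [Real.div_rpow (by positivity) hA.le, div_le_iff₀ (by positivity)] at this
    linarith


/-- The Taylor-expansion inequality from Section 2. -/
theorem stmt_16 (p L : ℝ) (hp : 0 < p) (hp' : p ≤ 1 / 3) (hL : 1 ≤ L)
    (x : ℝ) (hx : 1 ≤ x) :
    (L - p) / (p * x) ≤
      (1 + (L / p - 2) / x) ^ (1 / (1 - p)) -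
        (1 + L / x) ^ (-(p / (1 - p))) * (1 + (L - 1) / x) ^ ((1 + p) / (1 - p)) := by
  obtain ⟨k, hk⟩ : ∃ k, k = (1 - p) / p := ⟨_, rfl⟩
  have hp1 : 0 < 1 - p := by linarith
  have hk2 : 2 ≤ k := by
    rw [hk, le_div_iff₀ hp]
    linarith
  have hx0 : 0 < x := by linarith
  have hC : 0 < 1 + (L - 1) / x := by
    have : 0 ≤ L - 1 := by linarith
    positivity
  have hB : 0 < 1 + L / x := by positivity
  have hkL : k * L + L = L / p := by
    rw [hk]
    field_simp
    ring
  have hA : 0 < 1 + (L / p - 2) / x := by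
    have : 0 < L / p - 2 := by
      rw [← hkL]
      nlinarith
    positivity
  have hkp : 1 / k = p / (1 - p) := by rw [hk, one_div_div]
  have h := copson_core hk2 hL hx
  rw [hkL, hkp, Real.div_rpow (by positivity) hB.le, ← Real.rpow_natCast_mul hC.le] at h
  have e1 : 1 / (1 - p) = 1 + p / (1 - p) := by field_simp; ring
  have e2 : (1 + p) / (1 - p) = 1 + ((2 : ℕ) : ℝ) * (p / (1 - p)) := by
    push_cast
    field_simp
    ring
  have e3 : (L - p) / (p * x) = (L / p - 1) / x := by field_simp
  rw [e1, e2, e3, Real.rpow_add hA, Real.rpow_add hC, Real.rpow_one, Real.rpow_one,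
    Real.rpow_neg hB.le]
  refine h.trans_eq ?_
  ring
end
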